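/- arXiv:0705.3839 — 3 statements merged into one kernel-verified Lean document; each statement's English description precedes it below -/
import Mathlib

section
/- Let (V,b) ≈ (V',b') be nonsingular finite-dimensional metric spaces over F with subspaces E ⊆ V and E' ⊆ V', and let 𝒱 = {V_i}_{i=0,…,k} and 𝒱' = {V_i'}_{i=0,…,k} be isometric self-dual flags of V and V' respectively. Writing E_i := E ∩ V_i and E_i' := E' ∩ V_i', there exists an isometry φ_V : V → V' with φ_V(E) = E' and φ_V(V_i) = V_i' for all i, if and only if E_i ≈ E_i' for i = 1,…,k and dim(E_i^⊥ ∩ E_j) = dim(E_i'^⊥ ∩ E_j') for all i, j with k − i < j < i ≤ k. -/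
open Module

namespace Witt

variable {F V V' : Type*} [Field F] [AddCommGroup V] [Module F V]
  [AddCommGroup V'] [Module F V']

/-- A linear equivalence `φ : E ≃ E'` between subspaces is an isometry if it
preserves the ambient bilinear forms. -/
def IsIsometryOn (B : LinearMap.BilinForm F V) (B' : LinearMap.BilinForm F V')
    (E : Submodule F V) (E' : Submodule F V') (φ : E ≃ₗ[F] E') : Prop :=
  ∀ u v : E, B' (φ u : V') (φ v : V') = B (u : V) (v : V)

/-- A linear equivalence of the whole spaces which preserves the forms. -/
def IsIsometry (B : LinearMap.BilinForm F V) (B' : LinearMap.BilinForm F V')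
    (ψ : V ≃ₗ[F] V') : Prop :=
  ∀ u v : V, B' (ψ u) (ψ v) = B u v

/-- The two metric spaces `(V,B)` and `(V',B')` are isometric. -/
def AreIsometric (B : LinearMap.BilinForm F V) (B' : LinearMap.BilinForm F V') : Prop :=
  ∃ ψ : V ≃ₗ[F] V', IsIsometry B B' ψ

/-- The subspaces `N ⊆ V` and `N' ⊆ V'` are isometric with respect to the
restrictions of the ambient forms. -/
def SubIsometric (B : LinearMap.BilinForm F V) (B' : LinearMap.BilinForm F V')
    (N : Submodule F V) (N' : Submodule F V') : Prop :=
  ∃ ψ : N ≃ₗ[F] N', IsIsometryOn B B' N N' ψ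

/-- A subspace is totally isotropic. -/
def TotIsotropic (B : LinearMap.BilinForm F V) (N : Submodule F V) : Prop :=
  ∀ u ∈ N, ∀ v ∈ N, B u v = 0

end Witt

open Module Witt

namespace Witt

section Basic

variable {F V V' : Type*} [Field F] [AddCommGroup V] [Module F V]
  [AddCommGroup V'] [Module F V']

/-- A linear map is form-preserving on the subspace `N`. -/
def PreservesOn (B : LinearMap.BilinForm F V) (B' : LinearMap.BilinForm F V')
    (f : V →ₗ[F] V') (N : Submodule F V) : Prop :=
  ∀ u ∈ N, ∀ v ∈ N, B' (f u) (f v) = B u v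

theorem SubIsometric.finrank_eq {B : LinearMap.BilinForm F V} {B' : LinearMap.BilinForm F V'}
    {N : Submodule F V} {N' : Submodule F V'} (h : SubIsometric B B' N N') :
    finrank F N = finrank F N' :=
  h.choose.finrank_eq

theorem SubIsometric.exists_linearMap {B : LinearMap.BilinForm F V}
    {B' : LinearMap.BilinForm F V'} {N : Submodule F V} {N' : Submodule F V'}
    (h : SubIsometric B B' N N') :
    ∃ f : V →ₗ[F] V', PreservesOn B B' f N ∧ N.map f = N' ∧ ∀ u ∈ N, f u = 0 → u = 0 := by
  obtain ⟨ψ, hψ⟩ := h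
  obtain ⟨f, hf⟩ := LinearMap.exists_extend (N'.subtype ∘ₗ ψ.toLinearMap)
  have hfu : ∀ u (hu : u ∈ N), f u = ψ ⟨u, hu⟩ := fun u hu =>
    LinearMap.congr_fun hf ⟨u, hu⟩
  refine ⟨f, fun u hu v hv => ?_, ?_, fun u hu h0 => ?_⟩
  · rw [hfu u hu, hfu v hv]
    exact hψ ⟨u, hu⟩ ⟨v, hv⟩
  · ext w
    constructor
    · rintro ⟨u, hu, rfl⟩
      rw [hfu u hu]
      exact Subtype.property _
    · intro hw
      refine ⟨ψ.symm ⟨w, hw⟩, Subtype.property _, ?_⟩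
      rw [hfu _ (Subtype.property _)]
      simp
  · rw [hfu u hu] at h0
    simpa using h0

theorem finrank_map_of_inj {f : V →ₗ[F] V'} {N : Submodule F V}
    (hinj : ∀ u ∈ N, f u = 0 → u = 0) : finrank F (N.map f) = finrank F N := by
  rw [← LinearMap.range_domRestrict]
  refine LinearMap.finrank_range_of_inj ?_
  rw [injective_iff_map_eq_zero]
  exact fun u hu => Subtype.ext (hinj u u.2 hu)

variable [FiniteDimensional F V']

theorem map_eq_of_finrank_eq {f : V →ₗ[F] V'} {N : Submodule F V} {N' : Submodule F V'}
    (hmaps : ∀ u ∈ N, f u ∈ N') (hinj : ∀ u ∈ N, f u = 0 → u = 0)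
    (hrank : finrank F N = finrank F N') : N.map f = N' :=
  Submodule.eq_of_le_of_finrank_eq (Submodule.map_le_iff_le_comap.2 hmaps)
    ((finrank_map_of_inj hinj).trans hrank)

theorem SubIsometric.of_linearMap {B : LinearMap.BilinForm F V}
    {B' : LinearMap.BilinForm F V'} {N : Submodule F V} {N' : Submodule F V'}
    {f : V →ₗ[F] V'} (hf : PreservesOn B B' f N) (hmaps : ∀ u ∈ N, f u ∈ N')
    (hinj : ∀ u ∈ N, f u = 0 → u = 0) (hrank : finrank F N = finrank F N') :
    SubIsometric B B' N N' := by
  have hi : Function.Injective (f.restrict hmaps) := by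
    rw [injective_iff_map_eq_zero]
    intro u hu
    exact Subtype.ext (hinj u u.2 (congrArg Subtype.val hu))
  exact ⟨LinearEquiv.ofInjectiveOfFinrankEq _ hi hrank, fun u v => hf u u.2 v v.2⟩

variable [FiniteDimensional F V]

theorem finrank_inf_ker_add_one {S : Submodule F V} {l : V →ₗ[F] F} {x : V} (hx : x ∈ S)
    (hlx : l x ≠ 0) : finrank F ↥(S ⊓ LinearMap.ker l) + 1 = finrank F S := by
  have h := LinearMap.finrank_range_add_finrank_ker (l.domRestrict S)
  have hr : LinearMap.range (l.domRestrict S) = ⊤ := by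
    rw [LinearMap.range_eq_top]
    refine LinearMap.surjective fun h0 => hlx ?_
    exact LinearMap.congr_fun h0 ⟨x, hx⟩
  have hk : finrank F (LinearMap.ker (l.domRestrict S)) = finrank F ↥(S ⊓ LinearMap.ker l) := by
    rw [LinearMap.ker_domRestrict, ← Submodule.map_comap_subtype, Submodule.finrank_map_subtype_eq]
  rw [hr, finrank_top, Module.finrank_self] at h
  omega

theorem finrank_inf_ker_eq {S : Submodule F V} {S' : Submodule F V'} {l : V →ₗ[F] F}
    {l' : V' →ₗ[F] F} {x : V} {x' : V'} (hlx : l x ≠ 0) (hlx' : l' x' ≠ 0)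
    (h : (x ∈ S ∧ x' ∈ S') ∨ (S ≤ LinearMap.ker l ∧ S' ≤ LinearMap.ker l'))
    (hr : finrank F S = finrank F S') :
    finrank F ↥(S ⊓ LinearMap.ker l) = finrank F ↥(S' ⊓ LinearMap.ker l') := by
  rcases h with ⟨h, h'⟩ | ⟨h, h'⟩
  · have := finrank_inf_ker_add_one h hlx
    have := finrank_inf_ker_add_one h' hlx'
    omega
  · rwa [inf_eq_left.2 h, inf_eq_left.2 h']

end Basic

section Cancellation

variable {F V V' : Type*} [Field F] [AddCommGroup V] [Module F V]
  [AddCommGroup V'] [Module F V'] [FiniteDimensional F V] [FiniteDimensional F V']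

theorem SubIsometric.inf_ker_of_ne_zero_of_eq {B : LinearMap.BilinForm F V}
    {B' : LinearMap.BilinForm F V'} (hB' : ∀ u v : V', B' u v = B' v u)
    {A : Submodule F V} {A' : Submodule F V'} {x : V} {x' : V'} {f : V →ₗ[F] V'}
    (hf : PreservesOn B B' f A) (hmap : A.map f = A') (hinj : ∀ u ∈ A, f u = 0 → u = 0)
    (hx : x ∈ A) (hx' : x' ∈ A') (hxx : B x x = B' x' x') (hne : B x x ≠ 0)
    (hw : B' (f x - x') (f x - x') ≠ 0) :
    SubIsometric B B' (A ⊓ LinearMap.ker (B x)) (A' ⊓ LinearMap.ker (B' x')) := by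
  set w := f x - x' with hwdef
  set q := B' w w with hq
  have hfA : ∀ u ∈ A, f u ∈ A' := fun u hu => hmap ▸ Submodule.mem_map_of_mem hu
  have hwA : w ∈ A' := A'.sub_mem (hfA x hx) hx'
  have hfx : B' (f x) (f x) = B' x' x' := by rw [hf x hx x hx, hxx]
  have hqx : q = 2 * B' w (f x) := by
    simp only [hq, hwdef, map_sub, LinearMap.sub_apply, hfx, hB' (f x) x']
    ring
  have hq' : ∀ v, B' w v = B' v w := fun v => hB' w v
  let h : V →ₗ[F] V' := f - ((2 / q) • (B' w ∘ₗ f)).smulRight w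
  have hh : ∀ v, h v = f v - (2 / q * B' w (f v)) • w := fun v => rfl
  have hhx : h x = x' := by
    rw [hh, show 2 / q * B' w (f x) = 1 by rw [div_mul_eq_mul_div, ← hqx, div_self hw]]
    simp [hwdef]
  have hiso : PreservesOn B B' h A := by
    intro u hu v hv
    rw [hh, hh, ← hf u hu v hv]
    simp only [map_sub, LinearMap.sub_apply, map_smul, LinearMap.smul_apply, smul_eq_mul,
      ← hq' (f u), ← hq]
    field_simp
    ring
  have hr : finrank F A = finrank F A' := by
    rw [← hmap, finrank_map_of_inj hinj]
  refine SubIsometric.of_linearMap (f := h) (fun u hu v hv => hiso u hu.1 v hv.1) ?_ ?_ ?_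
  · rintro u ⟨hu, hux⟩
    refine ⟨?_, ?_⟩
    · rw [hh]
      exact A'.sub_mem (hfA u hu) (A'.smul_mem _ hwA)
    · rw [SetLike.mem_coe, LinearMap.mem_ker] at hux ⊢
      rw [← hhx, hiso x hx u hu, hux]
  · rintro u ⟨hu, -⟩ h0
    have h1 : f u = (2 / q * B' w (f u)) • w := by rwa [hh, sub_eq_zero] at h0
    have h2 : B' w (f u) = 2 * B' w (f u) := by
      conv_lhs => rw [h1]
      rw [map_smul, smul_eq_mul, ← hq]
      field_simp
    have h3 : B' w (f u) = 0 := by linear_combination -h2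
    exact hinj u hu (by rw [h1, h3]; simp)
  · exact finrank_inf_ker_eq hne (hxx ▸ hne) (Or.inl ⟨hx, hx'⟩) hr

/-- Witt cancellation of an anisotropic vector. -/
theorem SubIsometric.inf_ker_of_ne_zero (hchar : (2 : F) ≠ 0) {B : LinearMap.BilinForm F V}
    {B' : LinearMap.BilinForm F V'} (hB' : ∀ u v : V', B' u v = B' v u)
    {A : Submodule F V} {A' : Submodule F V'} {x : V} {x' : V'}
    (h : SubIsometric B B' A A')
    (hx : x ∈ A) (hx' : x' ∈ A') (hxx : B x x = B' x' x') (hne : B x x ≠ 0) :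
    SubIsometric B B' (A ⊓ LinearMap.ker (B x)) (A' ⊓ LinearMap.ker (B' x')) := by
  obtain ⟨f, hf, hmap, hinj⟩ := h.exists_linearMap
  by_cases hw : B' (f x - x') (f x - x') = 0
  · have hw' : B' (f x - -x') (f x - -x') ≠ 0 := by
      intro hw'
      have hfx : B' (f x) (f x) = B x x := hf x hx x hx
      simp only [map_sub, LinearMap.sub_apply, map_neg, LinearMap.neg_apply, hfx, ← hxx] at hw hw'
      have : 2 * 2 * B x x = 0 := by linear_combination hw + hw'
      simp [hchar, hne] at this
    have := SubIsometric.inf_ker_of_ne_zero_of_eq hB' hf hmap hinj hx (A'.neg_mem hx')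
      (by simpa using hxx) hne hw'
    rwa [map_neg, show LinearMap.ker (-(B' x')) = LinearMap.ker (B' x') by ext; simp] at this
  · exact SubIsometric.inf_ker_of_ne_zero_of_eq hB' hf hmap hinj hx hx' hxx hne hw

/-- Cancellation of a nonzero radical vector. -/
theorem SubIsometric.inf_ker_of_radical {B : LinearMap.BilinForm F V}
    {B' : LinearMap.BilinForm F V'} (hB : ∀ u v : V, B u v = B v u)
    (hB' : ∀ u v : V', B' u v = B' v u)
    {A : Submodule F V} {A' : Submodule F V'} {x : V} {x' : V'} {l : V →ₗ[F] F}
    {l' : V' →ₗ[F] F} (h : SubIsometric B B' A A')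
    (hx : x ∈ A) (hx' : x' ∈ A') (hrad : ∀ v ∈ A, B x v = 0) (hrad' : ∀ v ∈ A', B' x' v = 0)
    (hl : l x = 1) (hl' : l' x' = 1) :
    SubIsometric B B' (A ⊓ LinearMap.ker l) (A' ⊓ LinearMap.ker l') := by
  obtain ⟨f, hf, hmap, hinj⟩ := h.exists_linearMap
  have hfA : ∀ u ∈ A, f u ∈ A' := fun u hu => hmap ▸ Submodule.mem_map_of_mem hu
  have hfinj : ∀ u ∈ A, ∀ v ∈ A, f u = f v → u = v := fun u hu v hv huv =>
    sub_eq_zero.1 (hinj _ (A.sub_mem hu hv) (by rw [map_sub, huv, sub_self]))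
  obtain ⟨p, hp, hpx⟩ : x' ∈ A.map f := hmap ▸ hx'
  have hp0 : p ≠ 0 := by
    rintro rfl
    rw [map_zero] at hpx
    simp [← hpx] at hl'
  obtain ⟨m, hm⟩ : ∃ m : V →ₗ[F] F, ∀ (c : V) (t : F), l c = 0 → c + m c • x = t • p → c = 0 := by
    by_cases hlp : l p = 0
    · obtain ⟨m, hmp⟩ : ∃ m : V →ₗ[F] F, m p ≠ 0 := by
        obtain ⟨m, hmp, -⟩ := Submodule.exists_le_ker_of_notMem (p := (⊥ : Submodule F V)) (v := p)
          (by simpa using hp0)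
        exact ⟨m, hmp⟩
      refine ⟨m, fun c t hc h => ?_⟩
      have h1 : m c = 0 := by simpa [hc, hl, hlp] using congrArg l h
      rw [h1, zero_smul, add_zero] at h
      have h2 : t = 0 := by simpa [h, hmp] using h1
      rw [h, h2, zero_smul]
    · refine ⟨0, fun c t hc h => ?_⟩
      simp only [LinearMap.zero_apply, zero_smul, add_zero] at h
      have h2 : t = 0 := by simpa [h, hlp] using hc
      rw [h, h2, zero_smul]
  let s : V →ₗ[F] V := LinearMap.id + m.smulRight x
  have hs : ∀ c, s c = c + m c • x := fun c => rfl
  have hsA : ∀ c ∈ A, s c ∈ A := fun c hc => A.add_mem hc (A.smul_mem _ hx)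
  let g : V →ₗ[F] V' := f ∘ₗ s - (l' ∘ₗ f ∘ₗ s).smulRight x'
  have hg : ∀ c, g c = f (s c) - l' (f (s c)) • x' := fun c => rfl
  refine SubIsometric.of_linearMap (f := g) ?_ ?_ ?_ ?_
  · rintro u ⟨hu, -⟩ v ⟨hv, -⟩
    have e1 : B' (g u) (g v) = B' (f (s u)) (f (s v)) := by
      simp only [hg, map_sub, LinearMap.sub_apply, map_smul, LinearMap.smul_apply,
        hrad' _ (hfA _ (hsA v hv)), hB' _ x', hrad' _ (hfA _ (hsA u hu)), hrad' _ hx', smul_zero,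
        sub_zero]
    rw [e1, hf _ (hsA u hu) _ (hsA v hv)]
    simp only [hs, map_add, LinearMap.add_apply, map_smul, LinearMap.smul_apply, hB _ x,
      hrad u hu, hrad v hv, hrad x hx, smul_zero, add_zero]
  · rintro u ⟨hu, -⟩
    refine ⟨A'.sub_mem (hfA _ (hsA u hu)) (A'.smul_mem _ hx'), ?_⟩
    simp [hg, hl']
  · rintro u ⟨hu, hul⟩ h0
    refine hm u (l' (f (s u))) hul (hfinj _ (hsA u hu) _ (A.smul_mem _ hp) ?_)
    rw [hg, sub_eq_zero] at h0
    rw [map_smul, hpx]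
    exact h0
  · exact finrank_inf_ker_eq (by simp [hl]) (by simp [hl']) (Or.inl ⟨hx, hx'⟩) h.finrank_eq

end Cancellation

section Filtration

variable {F V V' ι : Type*} [Field F] [AddCommGroup V] [Module F V]
  [AddCommGroup V'] [Module F V']

theorem exists_apply_eq_one {x : V} (hx : x ≠ 0) : ∃ l : V →ₗ[F] F, l x = 1 := by
  obtain ⟨m, hm, -⟩ := Submodule.exists_le_ker_of_notMem (p := (⊥ : Submodule F V)) (v := x)
    (by simpa using hx)
  exact ⟨(m x)⁻¹ • m, by simp [hm]⟩

theorem exists_eq_add_smul {S : Submodule F V} {l : V →ₗ[F] F} {x : V} (hl : l x = 1)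
    (hx : x ∈ S) : ∀ u ∈ S, ∃ n ∈ S ⊓ LinearMap.ker l, ∃ c : F, u = n + c • x := by
  intro u hu
  exact ⟨u - l u • x, ⟨S.sub_mem hu (S.smul_mem _ hx), by simp [hl]⟩, l u, by simp⟩

theorem PreservesOn.congr {B : LinearMap.BilinForm F V} {B' : LinearMap.BilinForm F V'}
    {f g : V →ₗ[F] V'} {N : Submodule F V} (hg : PreservesOn B B' g N)
    (h : ∀ u ∈ N, f u = g u) : PreservesOn B B' f N := by
  intro u hu v hv
  rw [h u hu, h v hv, hg u hu v hv]

theorem PreservesOn.of_exists_eq_add_smul {B : LinearMap.BilinForm F V}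
    {B' : LinearMap.BilinForm F V'} (hB : ∀ u v : V, B u v = B v u)
    (hB' : ∀ u v : V', B' u v = B' v u) {f : V →ₗ[F] V'} {N N₁ : Submodule F V} {x : V}
    (hf : PreservesOn B B' f N) (hxx : B' (f x) (f x) = B x x)
    (hxn : ∀ n ∈ N, B' (f x) (f n) = B x n)
    (h : ∀ u ∈ N₁, ∃ n ∈ N, ∃ c : F, u = n + c • x) : PreservesOn B B' f N₁ := by
  intro u hu v hv
  obtain ⟨n, hn, c, rfl⟩ := h u hu
  obtain ⟨m, hm, d, rfl⟩ := h v hv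
  simp only [map_add, map_smul, LinearMap.add_apply, LinearMap.smul_apply, smul_eq_mul,
    hf n hn m hm, hxx, hxn m hm, hB' (f n) (f x), hxn n hn, hB n x]

theorem exists_map_eq_of_inf_ker {A : ι → Submodule F V} {A' : ι → Submodule F V'}
    {l : V →ₗ[F] F} {l' : V' →ₗ[F] F} {x : V} {x' : V'} (hl : l x = 1) (hl' : l' x' = 1)
    (hd : ∀ i, (x ∈ A i ∧ x' ∈ A' i) ∨ (A i ≤ LinearMap.ker l ∧ A' i ≤ LinearMap.ker l'))
    (g : V →ₗ[F] V')
    (hg : ∀ i, (A i ⊓ LinearMap.ker l).map g = A' i ⊓ LinearMap.ker l') :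
    ∃ f : V →ₗ[F] V', f x = x' ∧ (∀ v, l v = 0 → f v = g v) ∧ ∀ i, (A i).map f = A' i := by
  let f : V →ₗ[F] V' := g ∘ₗ (LinearMap.id - l.smulRight x) + l.smulRight x'
  have hf : ∀ v, f v = g (v - l v • x) + l v • x' := fun v => rfl
  have hfx : f x = x' := by simp [hf, hl]
  have hfg : ∀ v, l v = 0 → f v = g v := fun v hv => by simp [hf, hv]
  refine ⟨f, hfx, hfg, fun i => ?_⟩
  have hker : (A i ⊓ LinearMap.ker l).map f = A' i ⊓ LinearMap.ker l' := by
    rw [← hg i]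
    refine SetLike.coe_injective ?_
    simp only [Submodule.map_coe]
    exact Set.image_congr fun v hv => hfg v hv.2
  rcases hd i with ⟨hx, hx'⟩ | ⟨h, h'⟩
  · refine le_antisymm ?_ fun w hw => ?_
    · rintro _ ⟨u, hu, rfl⟩
      obtain ⟨n, hn, c, rfl⟩ := exists_eq_add_smul hl hx u hu
      rw [map_add, map_smul, hfx]
      have : f n ∈ A' i ⊓ LinearMap.ker l' := hker ▸ Submodule.mem_map_of_mem hn
      exact (A' i).add_mem this.1 ((A' i).smul_mem _ hx')
    · obtain ⟨n, hn, c, rfl⟩ := exists_eq_add_smul hl' hx' w hw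
      rw [← hker] at hn
      obtain ⟨u, hu, rfl⟩ := hn
      refine ⟨u + c • x, (A i).add_mem hu.1 ((A i).smul_mem _ hx), ?_⟩
      rw [map_add, map_smul, hfx]
  · rwa [inf_eq_left.2 h, inf_eq_left.2 h'] at hker

theorem inf_orthogonal_inf_ker_eq {B : LinearMap.BilinForm F V} {T S : Submodule F V}
    {l : V →ₗ[F] F} {x : V} (hl : l x = 1) (hT : ∀ v ∈ T, B x v = 0)
    (hS : x ∈ S ∨ S ≤ LinearMap.ker l) :
    T ⊓ B.orthogonal (S ⊓ LinearMap.ker l) = T ⊓ B.orthogonal S := by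
  rcases hS with hx | hS
  · refine le_antisymm ?_ (inf_le_inf_left _ (LinearMap.BilinForm.orthogonal_le inf_le_left))
    rintro v ⟨hv, hvS⟩
    refine ⟨hv, fun u hu => ?_⟩
    obtain ⟨n, hn, c, rfl⟩ := exists_eq_add_smul hl hx u hu
    have hnv : B n v = 0 := hvS n hn
    simp [hnv, hT v hv]
  · rw [inf_eq_left.2 hS]

variable [FiniteDimensional F V']

theorem le_orthogonal_of_finrank_eq {B : LinearMap.BilinForm F V}
    {B' : LinearMap.BilinForm F V'} {S T : Submodule F V} {S' T' : Submodule F V'}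
    (hS : finrank F S = finrank F S')
    (h : finrank F ↥(S ⊓ B.orthogonal T) = finrank F ↥(S' ⊓ B'.orthogonal T'))
    (hle : S ≤ B.orthogonal T) : S' ≤ B'.orthogonal T' := by
  rw [inf_eq_left.2 hle, hS] at h
  exact inf_eq_left.1 (Submodule.eq_of_le_of_finrank_eq inf_le_left h.symm)

variable [FiniteDimensional F V] [LinearOrder ι] [WellFoundedLT ι] [OrderTop ι]

theorem exists_map_eq_of_finrank_eq (n : ℕ) :
    ∀ (A : ι → Submodule F V) (A' : ι → Submodule F V'), Monotone A → Monotone A' →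
      (∀ i, finrank F (A i) = finrank F (A' i)) → finrank F (A ⊤) = n →
      ∃ f : V →ₗ[F] V', ∀ i, (A i).map f = A' i := by
  induction n with
  | zero =>
    intro A A' hA hA' hr hn
    have h : ∀ i, A i = ⊥ := fun i =>
      le_bot_iff.1 ((Submodule.finrank_eq_zero.1 hn) ▸ hA le_top)
    have h' : ∀ i, A' i = ⊥ := fun i => by
      rw [← Submodule.finrank_eq_zero (R := F), ← hr, h, finrank_bot]
    exact ⟨0, fun i => by rw [h, h', Submodule.map_bot]⟩
  | succ n ih =>
    intro A A' hA hA' hr hn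
    have hbot : ∀ i, A i = ⊥ ↔ A' i = ⊥ := fun i => by
      rw [← Submodule.finrank_eq_zero (R := F), hr, Submodule.finrank_eq_zero]
    obtain ⟨i, hi, hmin⟩ := exists_minimal_of_wellFoundedLT (fun i => A i ≠ ⊥)
      ⟨⊤, fun h => by
        rw [show A ⊤ = ⊥ from h, finrank_bot] at hn
        omega⟩
    obtain ⟨x, hx, hx0⟩ := Submodule.exists_mem_ne_zero_of_ne_bot hi
    obtain ⟨x', hx', hx0'⟩ := Submodule.exists_mem_ne_zero_of_ne_bot (mt (hbot i).2 hi)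
    obtain ⟨l, hl⟩ := exists_apply_eq_one (F := F) hx0
    obtain ⟨l', hl'⟩ := exists_apply_eq_one (F := F) hx0'
    have hd : ∀ m, (x ∈ A m ∧ x' ∈ A' m) ∨
        (A m ≤ LinearMap.ker l ∧ A' m ≤ LinearMap.ker l') := by
      intro m
      rcases lt_or_ge m i with hm | hm
      · have h0 : A m = ⊥ := by
          by_contra h0
          exact absurd (hmin h0 hm.le) (not_le.2 hm)
        right
        rw [h0, (hbot m).1 h0]
        exact ⟨bot_le, bot_le⟩
      · exact Or.inl ⟨hA hm hx, hA' hm hx'⟩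
    obtain ⟨g, hg⟩ := ih (fun m => A m ⊓ LinearMap.ker l) (fun m => A' m ⊓ LinearMap.ker l')
      (fun a b h => inf_le_inf_right _ (hA h)) (fun a b h => inf_le_inf_right _ (hA' h))
      (fun m => finrank_inf_ker_eq (by simp [hl]) (by simp [hl']) (hd m) (hr m))
      (by
        have := finrank_inf_ker_add_one (hA le_top hx : x ∈ A ⊤) (l := l) (by simp [hl])
        omega)
    obtain ⟨f, -, -, hf⟩ := exists_map_eq_of_inf_ker hl hl' hd g hg
    exact ⟨f, hf⟩

end Filtration

section FilteredIsometry

variable {F V V' ι : Type*} [Field F] [AddCommGroup V] [Module F V]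
  [AddCommGroup V'] [Module F V'] [LinearOrder ι] [OrderTop ι]

theorem mem_or_le_ker_of_anisotropic {B : LinearMap.BilinForm F V} {A : ι → Submodule F V}
    (hA : Monotone A) {i : ι} {x : V}
    (hx : x ∈ A i) (hlt : ∀ m < i, A m ≤ B.orthogonal (A ⊤)) (m : ι) :
    (i ≤ m → x ∈ A m) ∧ (¬ i ≤ m → A m ≤ LinearMap.ker (B x)) :=
  ⟨fun h => hA h hx, fun h _ hv => hlt m (not_le.1 h) hv x (hA le_top hx)⟩

theorem mem_inf_or_le_ker_of_anisotropic {B : LinearMap.BilinForm F V}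
    (hB : ∀ u v : V, B u v = B v u) {A : ι → Submodule F V} (hA : Monotone A) {i : ι} {x : V}
    (hx : x ∈ A i) (hlt : ∀ m < i, A m ≤ B.orthogonal (A ⊤)) (m p : ι) :
    (i ≤ m ∧ p < i → x ∈ A m ⊓ B.orthogonal (A p)) ∧
      (¬ (i ≤ m ∧ p < i) → A m ⊓ B.orthogonal (A p) ≤ LinearMap.ker (B x)) := by
  refine ⟨fun h => ⟨hA h.1 hx, fun n hn => ?_⟩, fun h v hv => ?_⟩
  · exact (hB n x).trans (hlt p h.2 hn x (hA le_top hx))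
  · by_cases him : i ≤ m
    · exact hv.2 x (hA (not_lt.1 fun hp => h ⟨him, hp⟩) hx)
    · exact hlt m (not_le.1 him) hv.1 x (hA le_top hx)

/-- A hyperbolic pair adapted to the first two levels of the filtration `A` that pair
nontrivially. -/
structure IsAdaptedPair (B : LinearMap.BilinForm F V) (A : ι → Submodule F V) (i j : ι)
    (x y : V) : Prop where
  left_mem : x ∈ A i
  right_mem : y ∈ A j
  left_self : B x x = 0
  right_self : B y y = 0
  left_right : B x y = 1
  right_left : B y x = 1
  lt_left : ∀ m < i, A m ≤ B.orthogonal (A ⊤)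
  lt_right : ∀ m < j, A i ≤ B.orthogonal (A m)

theorem exists_isAdaptedPair (hchar : (2 : F) ≠ 0) {B : LinearMap.BilinForm F V}
    (hB : ∀ u v : V, B u v = B v u) {A : ι → Submodule F V} (hA : Monotone A) {i j : ι}
    (hij : i < j) (hi : ∀ m < i, A m ≤ B.orthogonal (A ⊤))
    (hj : ∀ m < j, A i ≤ B.orthogonal (A m)) (hne : ¬ A i ≤ B.orthogonal (A j)) :
    ∃ x y, IsAdaptedPair B A i j x y := by
  obtain ⟨x, hx, hxA⟩ := SetLike.not_le_iff_exists.1 hne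
  obtain ⟨y, hy, hyx⟩ : ∃ y ∈ A j, B y x ≠ 0 := by
    by_contra! h
    exact hxA h
  have hxx : B x x = 0 := hj i hij hx x hx
  set z := (B y x)⁻¹ • y with hz
  have hzx : B z x = 1 := by simp [hz, hyx]
  have hzA : z ∈ A j := (A j).smul_mem _ hy
  have h2 : ∀ c : F, c - c / 2 - c / 2 = 0 := fun c => by field_simp; ring
  have hxz : B x z = 1 := by rw [hB, hzx]
  refine ⟨x, z - (B z z / 2) • x, hx, (A j).sub_mem hzA ((A j).smul_mem _ (hA hij.le hx)), hxx,
    ?_, ?_, ?_, hi, hj⟩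
  · simp [hzx, hxz, hxx]
    field_simp
    ring
  · simp [hxx, hxz]
  · simp [hxx, hzx]

namespace IsAdaptedPair

variable {B : LinearMap.BilinForm F V} {A : ι → Submodule F V} {i j : ι} {x y : V}

theorem mem_or_le_ker_left (h : IsAdaptedPair B A i j x y) (hA : Monotone A)
    (m : ι) : (i ≤ m → x ∈ A m) ∧ (¬ i ≤ m → A m ≤ LinearMap.ker (B y)) :=
  ⟨fun hm => hA hm h.left_mem,
    fun hm _ hv => h.lt_left m (not_le.1 hm) hv y (hA le_top h.right_mem)⟩

theorem le_ker_of_lt (hB : ∀ u v : V, B u v = B v u) (h : IsAdaptedPair B A i j x y) {m : ι}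
    (hm : m < j) : A m ≤ LinearMap.ker (B x) :=
  fun v hv => (hB x v).trans (h.lt_right m hm h.left_mem v hv)

theorem mem_or_le_ker_right (hB : ∀ u v : V, B u v = B v u) (h : IsAdaptedPair B A i j x y)
    (hA : Monotone A) (m : ι) :
    (j ≤ m → y ∈ A m ⊓ LinearMap.ker (B y)) ∧
      (¬ j ≤ m → A m ⊓ LinearMap.ker (B y) ≤ LinearMap.ker (B x)) :=
  ⟨fun hm => ⟨hA hm h.right_mem, h.right_self⟩,
    fun hm => inf_le_left.trans (h.le_ker_of_lt hB (not_le.1 hm))⟩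

theorem mem_inf_or_le_ker_left (h : IsAdaptedPair B A i j x y)
    (hA : Monotone A) (m p : ι) :
    (i ≤ m ∧ p < j → x ∈ A m ⊓ B.orthogonal (A p)) ∧
      (¬ (i ≤ m ∧ p < j) → A m ⊓ B.orthogonal (A p) ≤ LinearMap.ker (B y)) := by
  refine ⟨fun hmp => ⟨hA hmp.1 h.left_mem, h.lt_right p hmp.2 h.left_mem⟩, fun hmp v hv => ?_⟩
  by_cases him : i ≤ m
  · exact hv.2 y (hA (not_lt.1 fun hp => hmp ⟨him, hp⟩) h.right_mem)
  · exact h.lt_left m (not_le.1 him) hv.1 y (hA le_top h.right_mem)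

theorem mem_inf_or_le_ker_right (hB : ∀ u v : V, B u v = B v u)
    (h : IsAdaptedPair B A i j x y) (hA : Monotone A) (m p : ι) :
    (j ≤ m ∧ p < i → y ∈ A m ⊓ B.orthogonal (A p) ⊓ LinearMap.ker (B y)) ∧
      (¬ (j ≤ m ∧ p < i) →
        A m ⊓ B.orthogonal (A p) ⊓ LinearMap.ker (B y) ≤ LinearMap.ker (B x)) := by
  refine ⟨fun hmp => ⟨⟨hA hmp.1 h.right_mem, fun n hn => ?_⟩, h.right_self⟩, fun hmp v hv => ?_⟩
  · exact (hB n y).trans (h.lt_left p hmp.2 hn y (hA le_top h.right_mem))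
  · by_cases hjm : j ≤ m
    · exact hv.1.2 x (hA (not_lt.1 fun hp => hmp ⟨hjm, hp⟩) h.left_mem)
    · exact h.le_ker_of_lt hB (not_le.1 hjm) hv.1.1

theorem inf_orthogonal_eq (hB : ∀ u v : V, B u v = B v u) (h : IsAdaptedPair B A i j x y)
    (hA : Monotone A) (m p : ι) :
    A m ⊓ LinearMap.ker (B y) ⊓ LinearMap.ker (B x) ⊓
        B.orthogonal (A p ⊓ LinearMap.ker (B y) ⊓ LinearMap.ker (B x)) =
      A m ⊓ B.orthogonal (A p) ⊓ LinearMap.ker (B y) ⊓ LinearMap.ker (B x) := by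
  rw [inf_orthogonal_inf_ker_eq (T := A m ⊓ LinearMap.ker (B y) ⊓ LinearMap.ker (B x))
      (S := A p ⊓ LinearMap.ker (B y)) h.left_right (fun v hv => hv.1.2),
    inf_orthogonal_inf_ker_eq (T := A m ⊓ LinearMap.ker (B y) ⊓ LinearMap.ker (B x))
      (S := A p) h.right_left (fun v hv => hv.2)]
  · ac_rfl
  · exact (em (i ≤ p)).imp (h.mem_or_le_ker_left hA p).1 (h.mem_or_le_ker_left hA p).2
  · exact (em (j ≤ p)).imp (h.mem_or_le_ker_right hB hA p).1 (h.mem_or_le_ker_right hB hA p).2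

end IsAdaptedPair

theorem and_or_and_of_imp {P a b c d : Prop} (h : (P → a) ∧ (¬ P → b))
    (h' : (P → c) ∧ (¬ P → d)) : (a ∧ c) ∨ (b ∧ d) := by
  tauto

theorem inf_ker_add_inf_ker_sub (hchar : (2 : F) ≠ 0) (B : LinearMap.BilinForm F V)
    (S : Submodule F V) (x y : V) :
    S ⊓ LinearMap.ker (B (x + y)) ⊓ LinearMap.ker (B (x - y)) =
      S ⊓ LinearMap.ker (B y) ⊓ LinearMap.ker (B x) := by
  ext v
  simp only [Submodule.mem_inf, LinearMap.mem_ker, map_add, map_sub, LinearMap.add_apply,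
    LinearMap.sub_apply]
  constructor
  · rintro ⟨⟨hv, h1⟩, h2⟩
    refine ⟨⟨hv, ?_⟩, ?_⟩
    · exact (mul_eq_zero.1 (by linear_combination h1 - h2 : 2 * B y v = 0)).resolve_left hchar
    · exact (mul_eq_zero.1 (by linear_combination h1 + h2 : 2 * B x v = 0)).resolve_left hchar
  · rintro ⟨⟨hv, h1⟩, h2⟩
    simp [hv, h1, h2]

variable [FiniteDimensional F V] [FiniteDimensional F V']
  {B : LinearMap.BilinForm F V} {B' : LinearMap.BilinForm F V'}
  {A : ι → Submodule F V} {A' : ι → Submodule F V'}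

theorem IsAdaptedPair.subIsometric (hchar : (2 : F) ≠ 0) (hB : ∀ u v : V, B u v = B v u)
    (hB' : ∀ u v : V', B' u v = B' v u) (hA : Monotone A) (hA' : Monotone A')
    {i j : ι} (hij : i < j) {x y : V} {x' y' : V'}
    (h : IsAdaptedPair B A i j x y) (h' : IsAdaptedPair B' A' i j x' y')
    (m : ι) (hm : SubIsometric B B' (A m) (A' m)) :
    SubIsometric B B' (A m ⊓ LinearMap.ker (B y) ⊓ LinearMap.ker (B x))
      (A' m ⊓ LinearMap.ker (B' y') ⊓ LinearMap.ker (B' x')) := by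
  rcases lt_or_ge m j with hmj | hjm
  · rw [inf_eq_left.2 ((h.mem_or_le_ker_right hB hA m).2 (not_le.2 hmj)),
      inf_eq_left.2 ((h'.mem_or_le_ker_right hB' hA' m).2 (not_le.2 hmj))]
    rcases lt_or_ge m i with hmi | him
    · rwa [inf_eq_left.2 ((h.mem_or_le_ker_left hA m).2 (not_le.2 hmi)),
        inf_eq_left.2 ((h'.mem_or_le_ker_left hA' m).2 (not_le.2 hmi))]
    · exact hm.inf_ker_of_radical hB hB' (hA him h.left_mem) (hA' him h'.left_mem)
        (h.le_ker_of_lt hB hmj) (h'.le_ker_of_lt hB' hmj) h.right_left h'.right_left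
  · have hx := hA (hij.le.trans hjm) h.left_mem
    have hy := hA hjm h.right_mem
    have hx' := hA' (hij.le.trans hjm) h'.left_mem
    have hy' := hA' hjm h'.right_mem
    rw [← inf_ker_add_inf_ker_sub hchar B (A m) x y,
      ← inf_ker_add_inf_ker_sub hchar B' (A' m) x' y']
    have e1 := h.left_self
    have e2 := h.right_self
    have e3 := h.left_right
    have e4 := h.right_left
    have e1' := h'.left_self
    have e2' := h'.right_self
    have e3' := h'.left_right
    have e4' := h'.right_left
    have two : (1 : F) + 1 = 2 := one_add_one_eq_two
    refine (hm.inf_ker_of_ne_zero hchar hB' ((A m).add_mem hx hy) ((A' m).add_mem hx' hy')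
      ?_ ?_).inf_ker_of_ne_zero hchar hB' ⟨(A m).sub_mem hx hy, ?_⟩
      ⟨(A' m).sub_mem hx' hy', ?_⟩ ?_ ?_
    · simp [e1, e2, e3, e4, e1', e2', e3', e4']
    · simpa [e1, e2, e3, e4, two] using hchar
    · simp [e1, e2, e3, e4]
    · simp [e1', e2', e3', e4']
    · simp [e1, e2, e3, e4, e1', e2', e3', e4']
    · have : (-1 : F) - 1 = -2 := by ring
      simpa [e1, e2, e3, e4, this] using hchar

/-- Two filtered metric spaces with termwise isometric filtrations and equal ranks of all the
pairings between filtration steps are filtered isometric. -/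
theorem exists_preservesOn_map_eq [WellFoundedLT ι] (hchar : (2 : F) ≠ 0)
    (hB : ∀ u v : V, B u v = B v u) (hB' : ∀ u v : V', B' u v = B' v u) (n : ℕ) :
    ∀ (A : ι → Submodule F V) (A' : ι → Submodule F V'), Monotone A → Monotone A' →
      (∀ m, SubIsometric B B' (A m) (A' m)) →
      (∀ m p, finrank F ↥(A m ⊓ B.orthogonal (A p)) =
        finrank F ↥(A' m ⊓ B'.orthogonal (A' p))) →
      finrank F (A ⊤) = n →
      ∃ f : V →ₗ[F] V', PreservesOn B B' f (A ⊤) ∧ ∀ m, (A m).map f = A' m := by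
  induction n using Nat.strong_induction_on with
  | _ n ih =>
  intro A A' hA hA' h1 h2 hn
  have hle : ∀ m p, A m ≤ B.orthogonal (A p) → A' m ≤ B'.orthogonal (A' p) := fun m p =>
    le_orthogonal_of_finrank_eq (h1 m).finrank_eq (h2 m p)
  by_cases h0 : A ⊤ ≤ B.orthogonal (A ⊤)
  · obtain ⟨f, hf⟩ := exists_map_eq_of_finrank_eq _ A A' hA hA' (fun m => (h1 m).finrank_eq) rfl
    refine ⟨f, fun u hu v hv => ?_, hf⟩
    have hu' : f u ∈ A' ⊤ := hf ⊤ ▸ Submodule.mem_map_of_mem hu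
    have hv' : f v ∈ A' ⊤ := hf ⊤ ▸ Submodule.mem_map_of_mem hv
    exact (hle ⊤ ⊤ h0 hv' _ hu').trans (h0 hv u hu).symm
  obtain ⟨i, hi, hmin⟩ := exists_minimal_of_wellFoundedLT
    (fun i => ¬ A i ≤ B.orthogonal (A ⊤)) ⟨⊤, h0⟩
  have hilt : ∀ m < i, A m ≤ B.orthogonal (A ⊤) := fun m hm => by
    by_contra h
    exact absurd (hmin h hm.le) (not_le.2 hm)
  obtain ⟨j, hj, hminj⟩ := exists_minimal_of_wellFoundedLT
    (fun j => ¬ A i ≤ B.orthogonal (A j)) ⟨⊤, hi⟩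
  have hjlt : ∀ m < j, A i ≤ B.orthogonal (A m) := fun m hm => by
    by_contra h
    exact absurd (hminj h hm.le) (not_le.2 hm)
  have hilt' : ∀ m < i, A' m ≤ B'.orthogonal (A' ⊤) := fun m hm => hle _ _ (hilt m hm)
  have hjlt' : ∀ m < j, A' i ≤ B'.orthogonal (A' m) := fun m hm => hle _ _ (hjlt m hm)
  have hij : i ≤ j := by
    by_contra! hlt
    refine hj fun v hv w hw => (hB w v).trans ?_
    exact hilt j hlt hw v (hA le_top hv)
  rcases hij.lt_or_eq with hij | rfl
  · obtain ⟨x, y, h⟩ := exists_isAdaptedPair hchar hB hA hij hilt hjlt hj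
    have hj' : ¬ A' i ≤ B'.orthogonal (A' j) := fun hj' =>
      hj (le_orthogonal_of_finrank_eq (h1 i).finrank_eq.symm (h2 i j).symm hj')
    obtain ⟨x', y', h'⟩ := exists_isAdaptedPair hchar hB' hA' hij hilt' hjlt' hj'
    have hd := fun m =>
      and_or_and_of_imp (h.mem_or_le_ker_left hA m) (h'.mem_or_le_ker_left hA' m)
    have hd' := fun m =>
      and_or_and_of_imp (h.mem_or_le_ker_right hB hA m) (h'.mem_or_le_ker_right hB' hA' m)
    have hxT : x ∈ A ⊤ := hA le_top h.left_mem
    have hyT : y ∈ A ⊤ := hA le_top h.right_mem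
    obtain ⟨g, hgp, hg⟩ := ih (finrank F
        ↥(A ⊤ ⊓ LinearMap.ker (B y) ⊓ LinearMap.ker (B x))) (by
          have e1 := finrank_inf_ker_add_one hxT (l := B y) (by simp [h.right_left])
          have e2 := Submodule.finrank_mono (inf_le_left :
            A ⊤ ⊓ LinearMap.ker (B y) ⊓ LinearMap.ker (B x) ≤ A ⊤ ⊓ LinearMap.ker (B y))
          omega)
      (fun m => A m ⊓ LinearMap.ker (B y) ⊓ LinearMap.ker (B x))
      (fun m => A' m ⊓ LinearMap.ker (B' y') ⊓ LinearMap.ker (B' x'))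
      (fun a b hab => inf_le_inf_right _ (inf_le_inf_right _ (hA hab)))
      (fun a b hab => inf_le_inf_right _ (inf_le_inf_right _ (hA' hab)))
      (fun m => h.subIsometric hchar hB hB' hA hA' hij h' m (h1 m))
      (fun m p => by
        rw [h.inf_orthogonal_eq hB hA, h'.inf_orthogonal_eq hB' hA']
        refine finrank_inf_ker_eq (x := y) (x' := y') (by simp [h.left_right])
          (by simp [h'.left_right]) (and_or_and_of_imp (h.mem_inf_or_le_ker_right hB hA m p)
            (h'.mem_inf_or_le_ker_right hB' hA' m p)) ?_
        exact finrank_inf_ker_eq (x := x) (x' := x') (by simp [h.right_left])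
          (by simp [h'.right_left]) (and_or_and_of_imp (h.mem_inf_or_le_ker_left hA m p)
            (h'.mem_inf_or_le_ker_left hA' m p)) (h2 m p)) rfl
    obtain ⟨f₂, hf₂y, hf₂g, hf₂⟩ := exists_map_eq_of_inf_ker
      (A := fun m => A m ⊓ LinearMap.ker (B y))
      (A' := fun m => A' m ⊓ LinearMap.ker (B' y')) h.left_right h'.left_right hd' g hg
    obtain ⟨f, hfx, hff₂, hf⟩ := exists_map_eq_of_inf_ker h.right_left h'.right_left hd f₂ hf₂
    refine ⟨f, ?_, hf⟩
    have hfy : f y = y' := (hff₂ y h.right_self).trans hf₂y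
    have hfg : ∀ u ∈ A ⊤ ⊓ LinearMap.ker (B y) ⊓ LinearMap.ker (B x), f u = g u :=
      fun u hu => (hff₂ u hu.1.2).trans (hf₂g u hu.2)
    have hfmem : ∀ u ∈ A ⊤ ⊓ LinearMap.ker (B y) ⊓ LinearMap.ker (B x),
        f u ∈ A' ⊤ ⊓ LinearMap.ker (B' y') ⊓ LinearMap.ker (B' x') := fun u hu => by
      rw [hfg u hu, ← hg ⊤]
      exact Submodule.mem_map_of_mem hu
    have hdec := exists_eq_add_smul (S := A ⊤ ⊓ LinearMap.ker (B y)) h.left_right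
      ⟨hyT, h.right_self⟩
    have hp₁ : PreservesOn B B' f (A ⊤ ⊓ LinearMap.ker (B y)) := by
      refine (hgp.congr hfg).of_exists_eq_add_smul hB hB' (x := y) ?_ (fun u hu => ?_) hdec
      · rw [hfy, h.right_self, h'.right_self]
      · rw [hfy]
        exact (hfmem u hu).1.2.trans hu.1.2.symm
    refine hp₁.of_exists_eq_add_smul hB hB' (x := x) ?_ (fun u hu => ?_)
      (exists_eq_add_smul h.right_left hxT)
    · rw [hfx, h.left_self, h'.left_self]
    · obtain ⟨v, hv, c, rfl⟩ := hdec u hu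
      have e1 : B' x' (f v) = 0 := (hfmem v hv).2
      have e2 : B x v = 0 := hv.2
      simp [hfx, hfy, e1, e2, h.left_right, h'.left_right]
  · obtain ⟨x, hx, hxx⟩ : ∃ x ∈ A i, B x x ≠ 0 := by
      by_contra! hall
      refine hj fun v hv w hw => ?_
      have e := hall (v + w) ((A i).add_mem hv hw)
      simp only [map_add, LinearMap.add_apply, hall v hv, hall w hw, hB v w] at e
      exact (mul_eq_zero.1 (by linear_combination e : 2 * B w v = 0)).resolve_left hchar
    obtain ⟨ψ, hψ⟩ := h1 i
    obtain ⟨x', hx', hxx'⟩ : ∃ x' ∈ A' i, B x x = B' x' x' :=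
      ⟨ψ ⟨x, hx⟩, Subtype.property _, (hψ ⟨x, hx⟩ ⟨x, hx⟩).symm⟩
    have hne' : B' x' x' ≠ 0 := hxx' ▸ hxx
    have hxT : x ∈ A ⊤ := hA le_top hx
    have hd := fun m => and_or_and_of_imp (mem_or_le_ker_of_anisotropic hA hx hilt m)
      (mem_or_le_ker_of_anisotropic hA' hx' hilt' m)
    have hl : ((B x x)⁻¹ • B x) x = 1 := by simp [hxx]
    have hl' : ((B' x' x')⁻¹ • B' x') x' = 1 := by simp [hne']
    have hker : LinearMap.ker ((B x x)⁻¹ • B x) = LinearMap.ker (B x) :=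
      LinearMap.ker_smul _ _ (inv_ne_zero hxx)
    have hker' : LinearMap.ker ((B' x' x')⁻¹ • B' x') = LinearMap.ker (B' x') :=
      LinearMap.ker_smul _ _ (inv_ne_zero hne')
    have hperp : ∀ m p, A m ⊓ LinearMap.ker (B x) ⊓ B.orthogonal (A p ⊓ LinearMap.ker (B x)) =
        A m ⊓ B.orthogonal (A p) ⊓ LinearMap.ker (B x) := fun m p => by
      rw [← hker, inf_orthogonal_inf_ker_eq
        (T := A m ⊓ LinearMap.ker ((B x x)⁻¹ • B x)) (S := A p) hl
        (fun v hv => (hker.le hv.2)), inf_right_comm]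
      rw [hker]
      exact (hd p).imp And.left And.left
    have hperp' : ∀ m p, A' m ⊓ LinearMap.ker (B' x') ⊓
        B'.orthogonal (A' p ⊓ LinearMap.ker (B' x')) =
        A' m ⊓ B'.orthogonal (A' p) ⊓ LinearMap.ker (B' x') := fun m p => by
      rw [← hker', inf_orthogonal_inf_ker_eq
        (T := A' m ⊓ LinearMap.ker ((B' x' x')⁻¹ • B' x')) (S := A' p) hl'
        (fun v hv => (hker'.le hv.2)), inf_right_comm]
      rw [hker']
      exact (hd p).imp And.right And.right
    obtain ⟨g, hgp, hg⟩ := ih (finrank F ↥(A ⊤ ⊓ LinearMap.ker (B x))) (by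
          have := finrank_inf_ker_add_one hxT hxx
          omega)
      (fun m => A m ⊓ LinearMap.ker (B x)) (fun m => A' m ⊓ LinearMap.ker (B' x'))
      (fun a b hab => inf_le_inf_right _ (hA hab)) (fun a b hab => inf_le_inf_right _ (hA' hab))
      (fun m => by
        rcases hd m with ⟨hm, hm'⟩ | ⟨hm, hm'⟩
        · exact (h1 m).inf_ker_of_ne_zero hchar hB' hm hm' hxx' hxx
        · simpa only [inf_eq_left.2 hm, inf_eq_left.2 hm'] using h1 m)
      (fun m p => by
        rw [hperp, hperp']
        exact finrank_inf_ker_eq hxx hne' (and_or_and_of_imp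
          (mem_inf_or_le_ker_of_anisotropic hB hA hx hilt m p)
          (mem_inf_or_le_ker_of_anisotropic hB' hA' hx' hilt' m p)) (h2 m p)) rfl
    obtain ⟨f, hfx, hfg, hf⟩ := exists_map_eq_of_inf_ker (A := A) (A' := A') hl hl'
      (by simpa only [hker, hker'] using hd) g (by simpa only [hker, hker'] using hg)
    have hfg' : ∀ u ∈ A ⊤ ⊓ LinearMap.ker (B x), f u = g u :=
      fun u hu => hfg u (hker.ge hu.2)
    refine ⟨f, (hgp.congr hfg').of_exists_eq_add_smul hB hB' (x := x) ?_ (fun u hu => ?_)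
      (hker ▸ exists_eq_add_smul hl hxT), hf⟩
    · rw [hfx, hxx']
    · have hgu : g u ∈ A' ⊤ ⊓ LinearMap.ker (B' x') := hg ⊤ ▸ Submodule.mem_map_of_mem hu
      rw [hfx, hfg' u hu]
      exact hgu.2.trans hu.2.symm

end FilteredIsometry

section Orthogonal

variable {F V V' : Type*} [Field F] [AddCommGroup V] [Module F V]
  [AddCommGroup V'] [Module F V']

theorem isRefl_of_symm {B : LinearMap.BilinForm F V} (hB : ∀ u v : V, B u v = B v u) :
    B.IsRefl := fun u v h => (hB v u).trans h

theorem inf_ker_inf_orthogonal {B : LinearMap.BilinForm F V} (hB : ∀ u v : V, B u v = B v u)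
    {A N : Submodule F V} {z : V} (hz : z ∈ N) (hzz : B z z ≠ 0)
    (hr : ∀ u ∈ N, (∀ v ∈ N, B u v = 0) → ∀ v ∈ A, B u v = 0) :
    (∀ u ∈ N ⊓ LinearMap.ker (B z), (∀ v ∈ N ⊓ LinearMap.ker (B z), B u v = 0) →
      ∀ v ∈ A ⊓ LinearMap.ker (B z), B u v = 0) ∧
    A ⊓ LinearMap.ker (B z) ⊓ B.orthogonal (N ⊓ LinearMap.ker (B z)) = A ⊓ B.orthogonal N := by
  have hdec : ∀ u ∈ N, ∃ m ∈ N ⊓ LinearMap.ker (B z), ∃ c : F, u = m + c • z := by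
    intro u hu
    refine ⟨u - (B z u / B z z) • z, ⟨N.sub_mem hu (N.smul_mem _ hz), ?_⟩, _,
      (sub_add_cancel _ _).symm⟩
    simp [hzz]
  refine ⟨fun u hu huN v hv => hr u hu.1 (fun m hm => ?_) v hv.1, ?_⟩
  · obtain ⟨p, hp, c, rfl⟩ := hdec m hm
    have h0 : B z u = 0 := hu.2
    simp [huN p hp, hB u z, h0]
  · ext v
    constructor
    · rintro ⟨⟨hvA, hvz⟩, hv⟩
      refine ⟨hvA, fun m hm => ?_⟩
      obtain ⟨p, hp, c, rfl⟩ := hdec m hm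
      have h0 : B z v = 0 := hvz
      have h1 : B p v = 0 := hv p hp
      simp [h0, h1]
    · rintro ⟨hvA, hv⟩
      exact ⟨⟨hvA, hv z hz⟩, fun m hm => hv m hm.1⟩

variable [FiniteDimensional F V]

/-- Witt cancellation of a subspace whose radical is orthogonal to the ambient subspace. -/
theorem SubIsometric.inf_orthogonal [FiniteDimensional F V'] (hchar : (2 : F) ≠ 0)
    {B : LinearMap.BilinForm F V} {B' : LinearMap.BilinForm F V'}
    (hB : ∀ u v : V, B u v = B v u) (hB' : ∀ u v : V', B' u v = B' v u) (n : ℕ) :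
    ∀ (A N : Submodule F V) (A' N' : Submodule F V'), SubIsometric B B' A A' →
      SubIsometric B B' N N' → N ≤ A → N' ≤ A' →
      (∀ u ∈ N, (∀ v ∈ N, B u v = 0) → ∀ v ∈ A, B u v = 0) →
      (∀ u ∈ N', (∀ v ∈ N', B' u v = 0) → ∀ v ∈ A', B' u v = 0) →
      finrank F N = n → SubIsometric B B' (A ⊓ B.orthogonal N) (A' ⊓ B'.orthogonal N') := by
  induction n with
  | zero =>
    intro A N A' N' hA hN hNA hNA' hr hr' hn
    have h' : finrank F N' = 0 := by rw [← hN.finrank_eq, hn]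
    rw [Submodule.finrank_eq_zero] at hn h'
    subst hn h'
    simpa using hA
  | succ n ih =>
    intro A N A' N' hA hN hNA hNA' hr hr' hn
    obtain ⟨f, hf, hmap, hinj⟩ := hN.exists_linearMap
    have hfN : ∀ u ∈ N, f u ∈ N' := fun u hu => hmap ▸ Submodule.mem_map_of_mem hu
    by_cases hiso : ∀ z ∈ N, B z z = 0
    · have h1 : ∀ u ∈ N, ∀ v ∈ N, B u v = 0 := by
        intro u hu v hv
        have h := hiso (u + v) (N.add_mem hu hv)
        simp only [map_add, LinearMap.add_apply, hiso u hu, hiso v hv, hB v u] at h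
        have : 2 * B u v = 0 := by linear_combination h
        simpa [hchar] using this
      have h2 : ∀ u ∈ N', ∀ v ∈ N', B' u v = 0 := by
        rw [← hmap]
        rintro _ ⟨u, hu, rfl⟩ _ ⟨v, hv, rfl⟩
        rw [hf u hu v hv, h1 u hu v hv]
      have e1 : A ⊓ B.orthogonal N = A :=
        inf_eq_left.2 fun v hv u hu => hr u hu (h1 u hu) v hv
      have e2 : A' ⊓ B'.orthogonal N' = A' :=
        inf_eq_left.2 fun v hv u hu => hr' u hu (h2 u hu) v hv
      rwa [e1, e2]
    · push Not at hiso
      obtain ⟨z, hz, hzz⟩ := hiso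
      have hz' := hfN z hz
      have hzz' := hf z hz z hz
      obtain ⟨k1, k2⟩ := inf_ker_inf_orthogonal hB hz hzz hr
      obtain ⟨k1', k2'⟩ := inf_ker_inf_orthogonal hB' hz' (hzz'.symm ▸ hzz) hr'
      rw [← k2, ← k2']
      have hrank := finrank_inf_ker_add_one hz hzz
      exact ih _ _ _ _ (hA.inf_ker_of_ne_zero hchar hB' (hNA hz) (hNA' hz') hzz'.symm hzz)
        (hN.inf_ker_of_ne_zero hchar hB' hz hz' hzz'.symm hzz)
        (inf_le_inf_right _ hNA) (inf_le_inf_right _ hNA') k1 k1' (by omega)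

variable {B : LinearMap.BilinForm F V}

theorem finrank_inf_orthogonal_add (hB : ∀ u v : V, B u v = B v u) (hnd : B.Nondegenerate)
    (P Q : Submodule F V) :
    finrank F ↥(P ⊓ B.orthogonal Q) + finrank F Q =
      finrank F ↥(Q ⊓ B.orthogonal P) + finrank F P := by
  have e : B.orthogonal (B.orthogonal P ⊔ Q) = P ⊓ B.orthogonal Q := by
    conv_rhs => rw [← LinearMap.BilinForm.orthogonal_orthogonal hnd (isRefl_of_symm hB) P]
    refine le_antisymm (le_inf (LinearMap.BilinForm.orthogonal_le le_sup_left)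
      (LinearMap.BilinForm.orthogonal_le le_sup_right)) ?_
    rintro v ⟨h1, h2⟩ u hu
    obtain ⟨a, ha, b, hb, rfl⟩ := Submodule.mem_sup.1 hu
    have ha0 : B a v = 0 := h1 a ha
    have hb0 : B b v = 0 := h2 b hb
    simp [ha0, hb0]
  have h1 := LinearMap.BilinForm.finrank_orthogonal hnd (B.orthogonal P ⊔ Q)
  have h2 := LinearMap.BilinForm.finrank_orthogonal hnd P
  have h3 := Submodule.finrank_sup_add_finrank_inf_eq (B.orthogonal P) Q
  have h4 := Submodule.finrank_le P
  have h5 := Submodule.finrank_le (B.orthogonal P ⊔ Q)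
  rw [e] at h1
  rw [inf_comm Q]
  omega

theorem exists_mem_forall_apply_eq (hB : ∀ u v : V, B u v = B v u) (hnd : B.Nondegenerate)
    {S M : Submodule F V} {l : V →ₗ[F] F} (hl : ∀ m ∈ M, m ∈ B.orthogonal S → l m = 0) :
    ∃ w ∈ S, ∀ m ∈ M, B w m = l m := by
  have h : l ∈ (M ⊓ B.orthogonal S).dualAnnihilator :=
    (Submodule.mem_dualAnnihilator l).2 fun m hm => hl m hm.1 hm.2
  rw [Subspace.dualAnnihilator_inf_eq] at h
  obtain ⟨a, ha, b, hb, rfl⟩ := Submodule.mem_sup.1 h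
  rw [Submodule.mem_dualAnnihilator] at ha hb
  refine ⟨(B.toDual hnd).symm b, ?_, fun m hm => ?_⟩
  · rw [← LinearMap.BilinForm.orthogonal_orthogonal hnd (isRefl_of_symm hB) S]
    intro u hu
    change B u _ = 0
    rw [hB, LinearMap.BilinForm.apply_toDual_symm_apply]
    exact hb u hu
  · rw [LinearMap.BilinForm.apply_toDual_symm_apply, LinearMap.add_apply, ha m hm, zero_add]

theorem exists_mem_forall_apply_map_eq (hB : ∀ u v : V, B u v = B v u) (hnd : B.Nondegenerate)
    {S E : Submodule F V} {f : V →ₗ[F] V} (hinj : ∀ u ∈ E, f u = 0 → u = 0)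
    (hf : ∀ u ∈ E, f u ∈ B.orthogonal S → u ∈ B.orthogonal S) {l : V →ₗ[F] F}
    (hl : ∀ u ∈ E, u ∈ B.orthogonal S → l u = 0) :
    ∃ w ∈ S, ∀ u ∈ E, B w (f u) = l u := by
  obtain ⟨g, hg⟩ := (f.domRestrict E).exists_leftInverse_of_injective
    (LinearMap.ker_eq_bot'.2 fun u hu => Subtype.ext (hinj u u.2 hu))
  have hgf : ∀ u (hu : u ∈ E), g (f u) = ⟨u, hu⟩ := fun u hu => LinearMap.congr_fun hg ⟨u, hu⟩
  obtain ⟨w, hw, h⟩ := exists_mem_forall_apply_eq hB hnd (S := S) (M := E.map f)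
    (l := l ∘ₗ E.subtype ∘ₗ g) (by
      rintro _ ⟨u, hu, rfl⟩ hfu
      simpa [hgf u hu] using hl u hu (hf u hu hfu))
  exact ⟨w, hw, fun u hu => by simpa [hgf u hu] using h _ (Submodule.mem_map_of_mem hu)⟩

end Orthogonal

section FlagExtension

variable {F V : Type*} [Field F] [AddCommGroup V] [Module F V] [FiniteDimensional F V]
  {B : LinearMap.BilinForm F V} {f : V →ₗ[F] V} {E U S : Submodule F V}

theorem exists_extension_vector_of_isotropic (hB : ∀ u v : V, B u v = B v u)
    (hnd : B.Nondegenerate) (hinj : ∀ u ∈ E, f u = 0 → u = 0)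
    (hf : PreservesOn B B f E) (hS : ∀ u ∈ E, f u ∈ S ↔ u ∈ S)
    (hS' : ∀ u ∈ E, f u ∈ B.orthogonal S ↔ u ∈ B.orthogonal S)
    (hSE : ¬ S ≤ E) (hSS : S ≤ B.orthogonal S) :
    ∃ x ∈ S, x ∉ E ∧ ∃ y ∈ S, y ∉ E.map f ∧ (∀ u ∈ E, B y (f u) = B x u) ∧ B y y = B x x := by
  obtain ⟨x, hx, hxE⟩ := SetLike.not_le_iff_exists.1 hSE
  have hSS' : ∀ u ∈ S, ∀ v ∈ S, B u v = 0 := fun u hu v hv => hSS hv u hu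
  obtain ⟨y, hy, hyf⟩ := exists_mem_forall_apply_map_eq hB hnd (S := S) hinj
    (fun u hu => (hS' u hu).1) (l := B x) (fun u _ huS => huS x hx)
  by_cases hyE : y ∈ E.map f
  · obtain ⟨x₀, hx₀, rfl⟩ := hyE
    have hx₀S : x₀ ∈ S := (hS x₀ hx₀).1 hy
    obtain ⟨n, hn, hnE⟩ : ∃ n ∈ S ⊓ B.orthogonal (E.map f), n ∉ E.map f := by
      by_contra! hcon
      have h1 : S ⊓ B.orthogonal (E.map f) ≤ (S ⊓ B.orthogonal E ⊓ E).map f := by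
        intro n hn
        obtain ⟨u, hu, rfl⟩ := hcon n hn
        refine ⟨u, ⟨⟨(hS u hu).1 hn.1, fun v hv => ?_⟩, hu⟩, rfl⟩
        change B v u = 0
        rw [← hf v hv u hu]
        exact hn.2 _ (Submodule.mem_map_of_mem hv)
      have h2 : (E ⊓ B.orthogonal S).map f = E.map f ⊓ B.orthogonal S := by
        ext v
        constructor
        · rintro ⟨u, hu, rfl⟩
          exact ⟨Submodule.mem_map_of_mem hu.1, (hS' u hu.1).2 hu.2⟩
        · rintro ⟨⟨u, hu, rfl⟩, hv⟩
          exact ⟨u, ⟨hu, (hS' u hu).1 hv⟩, rfl⟩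
      have h3 := finrank_map_of_inj (f := f) (N := E ⊓ B.orthogonal S) fun u hu => hinj u hu.1
      have h4 := finrank_map_of_inj (f := f) (N := E) hinj
      have h5 := finrank_inf_orthogonal_add hB hnd S E
      have h6 := finrank_inf_orthogonal_add hB hnd S (E.map f)
      have h7 := (Submodule.finrank_mono h1).trans (Submodule.finrank_map_le f _)
      have h8 : finrank F ↥(S ⊓ B.orthogonal E ⊓ E) < finrank F ↥(S ⊓ B.orthogonal E) := by
        refine Submodule.finrank_lt_finrank_of_lt (inf_lt_left.2 fun hle => hxE ?_)
        have : x - x₀ ∈ E := hle ⟨S.sub_mem hx hx₀S, fun u hu => by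
          change B u (x - x₀) = 0
          rw [hB, map_sub, LinearMap.sub_apply, ← hyf u hu, hf x₀ hx₀ u hu, sub_self]⟩
        simpa using E.add_mem this hx₀
      rw [h2] at h3
      omega
    refine ⟨x, hx, hxE, f x₀ + n, S.add_mem hy hn.1, fun h => hnE ?_, fun u hu => ?_, ?_⟩
    · simpa using (E.map f).sub_mem h (Submodule.mem_map_of_mem hx₀)
    · have : B n (f u) = 0 := (hB _ _).trans (hn.2 _ (Submodule.mem_map_of_mem hu))
      rw [map_add, LinearMap.add_apply, hyf u hu, this, add_zero]
    · have h := S.add_mem hy hn.1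
      rw [hSS' _ h _ h, hSS' x hx x hx]
  · exact ⟨x, hx, hxE, y, hy, hyE, hyf, by rw [hSS' y hy y hy, hSS' x hx x hx]⟩

theorem exists_extension_vector_of_not_orthogonal (hchar : (2 : F) ≠ 0)
    (hB : ∀ u v : V, B u v = B v u)
    (hnd : B.Nondegenerate) (hinj : ∀ u ∈ E, f u = 0 → u = 0)
    (hf : PreservesOn B B f E) (hS : ∀ u ∈ E, f u ∈ S ↔ u ∈ S)
    (hS' : ∀ u ∈ E, f u ∈ B.orthogonal S ↔ u ∈ B.orthogonal S)
    {x n : V} (hx : x ∈ S) (hn : n ∈ E) (hnE : n ∈ B.orthogonal E) (hnS : n ∈ S)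
    (hxn : B x n ≠ 0) :
    ∃ x ∈ S, x ∉ E ∧ ∃ y ∈ S, y ∉ E.map f ∧ (∀ u ∈ E, B y (f u) = B x u) ∧ B y y = B x x := by
  obtain ⟨y, hy, hyf⟩ := exists_mem_forall_apply_map_eq hB hnd (S := S) hinj
    (fun u hu => (hS' u hu).1) (l := B x) (fun u _ huS => huS x hx)
  have hnf : ∀ u ∈ E, B (f n) (f u) = 0 := fun u hu =>
    (hf n hn u hu).trans ((hB _ _).trans (hnE u hu))
  have hy' : ∀ c : F, ∀ u ∈ E, B (y + c • f n) (f u) = B x u := fun c u hu => by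
    simp [hyf u hu, hnf u hu]
  refine ⟨x, hx, fun h => hxn (hnE x h), y + ((B x x - B y y) / (2 * B x n)) • f n,
    S.add_mem hy (S.smul_mem _ ((hS n hn).2 hnS)), fun h => hxn ?_, hy' _, ?_⟩
  · obtain ⟨u, hu, h⟩ := h
    rw [← hy' _ n hn, ← h, hf u hu n hn]
    exact hnE u hu
  · have h1 := hnf n hn
    have h2 := hyf n hn
    simp only [map_add, map_smul, LinearMap.add_apply, LinearMap.smul_apply, smul_eq_mul, h1,
      hB (f n) y, h2]
    field_simp
    ring

theorem exists_extension_vector_of_orthogonal (hchar : (2 : F) ≠ 0)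
    (hB : ∀ u v : V, B u v = B v u)
    (hnd : B.Nondegenerate) (hinj : ∀ u ∈ E, f u = 0 → u = 0)
    (hf : PreservesOn B B f E) (hS : ∀ u ∈ E, f u ∈ S ↔ u ∈ S)
    (hU : ∀ u ∈ E, f u ∈ U ↔ u ∈ U) (hUS : U ≤ S) (hUE : U ≤ E)
    (hSE : ¬ S ≤ E) (hSU : B.orthogonal S = U) (hE : E ⊓ B.orthogonal E ≤ U) :
    ∃ x ∈ S, x ∉ E ∧ ∃ y ∈ S, y ∉ E.map f ∧ (∀ u ∈ E, B y (f u) = B x u) ∧ B y y = B x x := by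
  have hrefl := isRefl_of_symm hB
  have hUo : B.orthogonal U = S := by
    rw [← hSU, LinearMap.BilinForm.orthogonal_orthogonal hnd hrefl]
  have hUSz : ∀ u ∈ U, ∀ v ∈ S, B u v = 0 := fun u hu v hv => by
    rw [← hUo] at hv
    exact hv u hu
  have hmapU : U.map f = U := map_eq_of_finrank_eq (fun u hu => (hU u (hUE hu)).2 hu)
    (fun u hu => hinj u (hUE hu)) rfl
  have hrad : ∀ e ∈ E ⊓ S, (∀ v ∈ E ⊓ S, B e v = 0) → e ∈ U := by
    intro e he hev
    have hEo : B.orthogonal (E ⊓ S) ≤ B.orthogonal E ⊔ U := by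
      have h : B.orthogonal (B.orthogonal E ⊔ U) ≤ E ⊓ S := by
        refine le_inf ?_ ?_
        · conv_rhs => rw [← LinearMap.BilinForm.orthogonal_orthogonal hnd hrefl E]
          exact LinearMap.BilinForm.orthogonal_le le_sup_left
        · rw [← hUo]
          exact LinearMap.BilinForm.orthogonal_le le_sup_right
      have h' := LinearMap.BilinForm.orthogonal_le (B := B) h
      rwa [LinearMap.BilinForm.orthogonal_orthogonal hnd hrefl] at h'
    obtain ⟨a, ha, u, hu, rfl⟩ := Submodule.mem_sup.1
      (hEo (show e ∈ B.orthogonal (E ⊓ S) from fun v hv => (hB v e).trans (hev v hv)))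
    have haE : a ∈ E := by simpa using E.sub_mem he.1 (hUE hu)
    exact U.add_mem (hE ⟨haE, ha⟩) hu
  have hoS : B.orthogonal (E ⊓ S) ≤ S :=
    (LinearMap.BilinForm.orthogonal_le (le_inf hUE hUS)).trans_eq hUo
  obtain ⟨x, hx, hxES⟩ : ∃ x ∈ B.orthogonal (E ⊓ S), x ∉ E ⊓ S := by
    by_contra! hcon
    refine hSE fun s hs => ?_
    have hle : B.orthogonal (E ⊓ S) ≤ U := fun x hx =>
      hrad x (hcon x hx) fun v hv => (hB x v).trans (hx v hv)
    have := LinearMap.BilinForm.orthogonal_le (B := B) hle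
    rw [hUo, LinearMap.BilinForm.orthogonal_orthogonal hnd hrefl] at this
    exact (this hs).1
  have hxS := hoS hx
  have hxE : x ∉ E := fun h => hxES ⟨h, hxS⟩
  have hESinj : ∀ u ∈ E ⊓ S, f u = 0 → u = 0 := fun u hu => hinj u hu.1
  have hESf : PreservesOn B B f (E ⊓ S) := fun u hu v hv => hf u hu.1 v hv.1
  obtain ⟨h, hh, hmap, -⟩ := (SubIsometric.inf_orthogonal hchar hB hB _ S (E ⊓ S) S
    ((E ⊓ S).map f) ⟨LinearEquiv.refl F S, fun u v => rfl⟩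
    (SubIsometric.of_linearMap hESf (fun u hu => Submodule.mem_map_of_mem hu) hESinj
      (finrank_map_of_inj hESinj).symm) inf_le_right
    (by
      rintro _ ⟨u, hu, rfl⟩
      exact (hS u hu.1).2 hu.2)
    (fun u hu hv => hUSz u (hrad u hu hv))
    (by
      rintro _ ⟨u, hu, rfl⟩ hv
      refine hUSz _ ((hU u hu.1).2 (hrad u hu fun v hvE => ?_))
      rw [← hf u hu.1 v hvE.1]
      exact hv _ (Submodule.mem_map_of_mem hvE)) rfl).exists_linearMap
  have hhx : h x ∈ S ⊓ B.orthogonal ((E ⊓ S).map f) := hmap ▸ Submodule.mem_map_of_mem ⟨hxS, hx⟩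
  have hhxo : ∀ u ∈ E ⊓ S, B (h x) (f u) = 0 := fun u hu =>
    (hB _ _).trans (hhx.2 _ (Submodule.mem_map_of_mem hu))
  have hhxE : h x ∉ E.map f := by
    rintro ⟨e, he, heq⟩
    have heS : e ∈ S := (hS e he).1 (by rw [heq]; exact hhx.1)
    have heU : e ∈ U := hrad e ⟨he, heS⟩ fun v hv => by
      rw [← hf e he v hv.1, heq]
      exact hhxo v hv
    have hxU : h x ∈ U := heq ▸ (hU e he).2 heU
    refine hxES ?_
    rw [← LinearMap.BilinForm.orthogonal_orthogonal hnd hrefl (E ⊓ S)]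
    intro v hv
    change B v x = 0
    rw [hB, ← hh x ⟨hxS, hx⟩ v ⟨hoS hv, hv⟩]
    have hhv : h v ∈ S ⊓ B.orthogonal ((E ⊓ S).map f) :=
      hmap ▸ Submodule.mem_map_of_mem ⟨hoS hv, hv⟩
    exact hUSz _ hxU _ hhv.1
  obtain ⟨g, hg⟩ : ∃ g : V →ₗ[F] F, ∀ u, g u = B x u - B (h x) (f u) :=
    ⟨B x - B (h x) ∘ₗ f, fun u => rfl⟩
  obtain ⟨w, hw, hwf⟩ := exists_mem_forall_apply_map_eq hB hnd (S := U) hinj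
    (fun u hu => by rw [hUo]; exact (hS u hu).1) (l := g) (fun u hu huS => by
      rw [hUo] at huS
      rw [hg, hhxo u ⟨hu, huS⟩, hB, sub_zero]
      exact hx u ⟨hu, huS⟩)
  refine ⟨x, hxS, hxE, h x + w, S.add_mem hhx.1 (hUS hw), fun hmem => hhxE ?_, fun u hu => ?_, ?_⟩
  · have hw' : w ∈ E.map f := Submodule.map_mono hUE (hmapU.symm ▸ hw)
    simpa using (E.map f).sub_mem hmem hw'
  · rw [map_add, LinearMap.add_apply, hwf u hu, hg]
    ring
  · have h1 := hUSz w hw (h x) hhx.1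
    have h2 := hUSz w hw w (hUS hw)
    have h3 := hh x ⟨hxS, hx⟩ x ⟨hxS, hx⟩
    simp only [map_add, LinearMap.add_apply, hB (h x) w, h1, h2, h3, add_zero]

theorem exists_extension_vector (hchar : (2 : F) ≠ 0) (hB : ∀ u v : V, B u v = B v u)
    (hnd : B.Nondegenerate) (hinj : ∀ u ∈ E, f u = 0 → u = 0)
    (hf : PreservesOn B B f E) (hS : ∀ u ∈ E, f u ∈ S ↔ u ∈ S)
    (hS' : ∀ u ∈ E, f u ∈ B.orthogonal S ↔ u ∈ B.orthogonal S)
    (hU : ∀ u ∈ E, f u ∈ U ↔ u ∈ U) (hUS : U ≤ S) (hUE : U ≤ E) (hSE : ¬ S ≤ E)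
    (h : S ≤ B.orthogonal S ∨
      B.orthogonal S ≤ U ∧ (B.orthogonal U ≤ U ∨ U = B.orthogonal S)) :
    ∃ x ∈ S, x ∉ E ∧ ∃ y ∈ S, y ∉ E.map f ∧ (∀ u ∈ E, B y (f u) = B x u) ∧ B y y = B x x := by
  have hrefl := isRefl_of_symm hB
  rcases h with h | ⟨h, hUU⟩
  · exact exists_extension_vector_of_isotropic hB hnd hinj hf hS hS' hSE h
  have hES : B.orthogonal E ≤ S := by
    rw [← LinearMap.BilinForm.orthogonal_orthogonal hnd hrefl S]
    exact LinearMap.BilinForm.orthogonal_le (h.trans hUE)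
  by_cases hE : E ⊓ B.orthogonal E ≤ B.orthogonal S
  · rcases hUU with hUU | rfl
    · have h1 : B.orthogonal E ≤ B.orthogonal S :=
        (le_inf (((LinearMap.BilinForm.orthogonal_le hUE).trans hUU).trans hUE) le_rfl).trans hE
      have h2 := LinearMap.BilinForm.orthogonal_le (B := B) h1
      simp only [LinearMap.BilinForm.orthogonal_orthogonal hnd hrefl] at h2
      exact absurd h2 hSE
    · exact exists_extension_vector_of_orthogonal hchar hB hnd hinj hf hS hU hUS hUE hSE rfl hE
  · obtain ⟨n, hn, hnS⟩ := SetLike.not_le_iff_exists.1 hE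
    obtain ⟨x, hx, hxn⟩ : ∃ x ∈ S, B x n ≠ 0 := by
      by_contra! hcon
      exact hnS hcon
    exact exists_extension_vector_of_not_orthogonal hchar hB hnd hinj hf hS hS' hx hn.1 hn.2
      (hES hn.2) hxn

end FlagExtension

section SelfDualFlag

variable {F V : Type*} [Field F] [AddCommGroup V] [Module F V]

/-- A linear map is form-preserving on `E` and preserves and reflects membership in the
members of the flag `𝒱` on `E`. -/
def FlagPreservesOn (B : LinearMap.BilinForm F V) (𝒱 : ℕ → Submodule F V) (k : ℕ)
    (f : V →ₗ[F] V) (E : Submodule F V) : Prop :=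
  PreservesOn B B f E ∧ ∀ l ≤ k, ∀ u ∈ E, (f u ∈ 𝒱 l ↔ u ∈ 𝒱 l)

variable {B : LinearMap.BilinForm F V} {𝒱 : ℕ → Submodule F V} {k : ℕ}

theorem flag_le (hmono : ∀ i < k, 𝒱 i ≤ 𝒱 (i + 1)) {i j : ℕ} (hij : i ≤ j) (hj : j ≤ k) :
    𝒱 i ≤ 𝒱 j := by
  induction j, hij using Nat.le_induction with
  | base => exact le_rfl
  | succ j hij ih => exact (ih (by omega)).trans (hmono j (by omega))

theorem FlagPreservesOn.eq_zero (h0 : 𝒱 0 = ⊥) {f : V →ₗ[F] V} {E : Submodule F V}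
    (hf : FlagPreservesOn B 𝒱 k f E) : ∀ u ∈ E, f u = 0 → u = 0 := by
  intro u hu hfu
  have := (hf.2 0 (Nat.zero_le k) u hu).1 (by rw [hfu]; exact Submodule.zero_mem _)
  simpa [h0] using this

variable [FiniteDimensional F V]

theorem FlagPreservesOn.exists_sup_span (hchar : (2 : F) ≠ 0)
    (hB : ∀ u v : V, B u v = B v u) (hnd : B.Nondegenerate) (h0 : 𝒱 0 = ⊥) (hk : 𝒱 k = ⊤)
    (hmono : ∀ i < k, 𝒱 i ≤ 𝒱 (i + 1)) (hsd : ∀ i ≤ k, B.orthogonal (𝒱 i) = 𝒱 (k - i))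
    {f : V →ₗ[F] V} {E : Submodule F V} (hf : FlagPreservesOn B 𝒱 k f E) (hE : E ≠ ⊤) :
    ∃ x ∉ E, ∃ g : V →ₗ[F] V, FlagPreservesOn B 𝒱 k g (E ⊔ F ∙ x) ∧ ∀ u ∈ E, g u = f u := by
  classical
  have hex : ∃ i, ¬ 𝒱 i ≤ E := ⟨k, fun h => hE (top_le_iff.1 (hk ▸ h))⟩
  obtain ⟨i, hi, hmin⟩ : ∃ i, ¬ 𝒱 i ≤ E ∧ ∀ l < i, 𝒱 l ≤ E :=
    ⟨Nat.find hex, Nat.find_spec hex, fun l hl => not_not.1 (Nat.find_min hex hl)⟩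
  have hik : i ≤ k := by
    by_contra! hlt
    exact hE (top_le_iff.1 (hk ▸ hmin k hlt))
  obtain ⟨i, rfl⟩ : ∃ j, i = j + 1 := by
    refine Nat.exists_eq_succ_of_ne_zero ?_
    rintro rfl
    exact hi (h0 ▸ bot_le)
  have hinj := hf.eq_zero h0
  obtain ⟨x, hx, hxE, y, hy, hyE, hyf, hyy⟩ := exists_extension_vector (S := 𝒱 (i + 1))
    (U := 𝒱 i) hchar hB hnd hinj hf.1 (hf.2 _ hik)
    (by rw [hsd _ hik]; exact hf.2 _ (Nat.sub_le _ _)) (hf.2 i (by omega))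
    (hmono i (by omega)) (hmin i (by omega)) hi (by
      rw [hsd _ hik, hsd i (by omega)]
      by_cases h1 : i + 1 ≤ k - (i + 1)
      · exact Or.inl (flag_le hmono h1 (Nat.sub_le _ _))
      refine Or.inr ⟨flag_le hmono (by omega) (by omega), ?_⟩
      by_cases h2 : k - i ≤ i
      · exact Or.inl (flag_le hmono h2 (by omega))
      · exact Or.inr (congrArg 𝒱 (by omega)))
  obtain ⟨l, hlx, hlE⟩ : ∃ l : V →ₗ[F] F, l x = 1 ∧ ∀ u ∈ E, l u = 0 := by
    obtain ⟨m, hm, hmE⟩ := Submodule.exists_le_ker_of_notMem hxE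
    exact ⟨(m x)⁻¹ • m, by simp [hm], fun u hu => by simp [LinearMap.mem_ker.1 (hmE hu)]⟩
  let g : V →ₗ[F] V := f + l.smulRight (y - f x)
  have hgE : ∀ u ∈ E, g u = f u := fun u hu => by simp [g, hlE u hu]
  have hgx : g x = y := by simp [g, hlx]
  have hdec : ∀ u ∈ E ⊔ F ∙ x, ∃ n ∈ E, ∃ c : F, u = n + c • x := by
    intro u hu
    obtain ⟨n, hn, m, hm, rfl⟩ := Submodule.mem_sup.1 hu
    obtain ⟨c, rfl⟩ := Submodule.mem_span_singleton.1 hm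
    exact ⟨n, hn, c, rfl⟩
  refine ⟨x, hxE, g, ⟨PreservesOn.of_exists_eq_add_smul hB hB (hf.1.congr hgE)
    (by rw [hgx, hyy]) (fun n hn => by rw [hgx, hgE n hn, hyf n hn]) hdec, ?_⟩, hgE⟩
  intro m hm u hu
  obtain ⟨n, hn, c, rfl⟩ := hdec u hu
  rw [map_add, map_smul, hgx, hgE n hn]
  rcases le_or_gt (i + 1) m with him | him
  · have hle := flag_le hmono him hm
    rw [Submodule.add_mem_iff_left _ ((𝒱 m).smul_mem _ (hle hy)),
      Submodule.add_mem_iff_left _ ((𝒱 m).smul_mem _ (hle hx))]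
    exact hf.2 m hm n hn
  · have hmE := hmin m him
    have hmap : (𝒱 m).map f = 𝒱 m := map_eq_of_finrank_eq
      (fun u hu => (hf.2 m hm u (hmE hu)).2 hu) (fun u hu => hinj u (hmE hu)) rfl
    have hc : ∀ (T : Submodule F V) (w n : V), w ∉ T → n ∈ T → n + c • w ∈ T → c = 0 := by
      intro T w n hw hn h
      by_contra hc
      exact hw ((T.smul_mem_iff hc).1 ((T.add_mem_iff_right hn).1 h))
    constructor
    · intro h
      have hc0 := hc (E.map f) y (f n) hyE (Submodule.mem_map_of_mem hn)
        (Submodule.map_mono hmE (hmap.symm ▸ h))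
      subst hc0
      simp only [zero_smul, add_zero] at h ⊢
      exact (hf.2 m hm n hn).1 h
    · intro h
      have hc0 := hc E x n hxE hn (hmE h)
      subst hc0
      simp only [zero_smul, add_zero] at h ⊢
      exact (hf.2 m hm n hn).2 h

/-- Witt extension for self-dual flags. -/
theorem FlagPreservesOn.exists_extend (hchar : (2 : F) ≠ 0)
    (hB : ∀ u v : V, B u v = B v u) (hnd : B.Nondegenerate) (h0 : 𝒱 0 = ⊥) (hk : 𝒱 k = ⊤)
    (hmono : ∀ i < k, 𝒱 i ≤ 𝒱 (i + 1)) (hsd : ∀ i ≤ k, B.orthogonal (𝒱 i) = 𝒱 (k - i))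
    (E : Submodule F V) {f : V →ₗ[F] V} (hf : FlagPreservesOn B 𝒱 k f E) :
    ∃ g : V →ₗ[F] V, FlagPreservesOn B 𝒱 k g ⊤ ∧ ∀ u ∈ E, g u = f u := by
  induction E using WellFoundedGT.induction generalizing f with
  | ind E ih =>
    by_cases hE : E = ⊤
    · exact ⟨f, hE ▸ hf, fun u _ => rfl⟩
    · obtain ⟨x, hx, g, hg, hgE⟩ := hf.exists_sup_span hchar hB hnd h0 hk hmono hsd hE
      obtain ⟨g', hg', h⟩ := ih (E ⊔ F ∙ x) (by simpa using hx) hg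
      exact ⟨g', hg', fun u hu => (h u (Submodule.mem_sup_left hu)).trans (hgE u hu)⟩

end SelfDualFlag

section Isometry

variable {F V V' : Type*} [Field F] [AddCommGroup V] [Module F V]
  [AddCommGroup V'] [Module F V'] {B : LinearMap.BilinForm F V} {B' : LinearMap.BilinForm F V'}

theorem PreservesOn.finrank_inf_orthogonal_eq {f : V →ₗ[F] V'} {E P Q : Submodule F V}
    (hf : PreservesOn B B' f E) (hinj : ∀ u ∈ E, f u = 0 → u = 0) (hP : P ≤ E) (hQ : Q ≤ E) :
    finrank F ↥(P ⊓ B.orthogonal Q) = finrank F ↥(P.map f ⊓ B'.orthogonal (Q.map f)) := by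
  have h : (P ⊓ B.orthogonal Q).map f = P.map f ⊓ B'.orthogonal (Q.map f) := by
    ext v
    constructor
    · rintro ⟨u, hu, rfl⟩
      refine ⟨Submodule.mem_map_of_mem hu.1, ?_⟩
      rintro _ ⟨w, hw, rfl⟩
      exact (hf w (hQ hw) u (hP hu.1)).trans (hu.2 w hw)
    · rintro ⟨⟨u, hu, rfl⟩, hv⟩
      exact ⟨u, ⟨hu, fun w hw => (hf w (hQ hw) u (hP hu)).symm.trans
        (hv _ (Submodule.mem_map_of_mem hw))⟩, rfl⟩
  rw [← h]
  exact (finrank_map_of_inj (N := P ⊓ B.orthogonal Q) fun u hu => hinj u (hP hu.1)).symm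

theorem SubIsometric.finrank_radical_eq {N : Submodule F V} {N' : Submodule F V'}
    (h : SubIsometric B B' N N') :
    finrank F ↥(N ⊓ B.orthogonal N) = finrank F ↥(N' ⊓ B'.orthogonal N') := by
  obtain ⟨f, hf, rfl, hinj⟩ := h.exists_linearMap
  exact hf.finrank_inf_orthogonal_eq hinj le_rfl le_rfl

variable [FiniteDimensional F V] [FiniteDimensional F V']

theorem finrank_inf_flag_inf_orthogonal_eq
    (hB : ∀ u v : V, B u v = B v u) (hB' : ∀ u v : V', B' u v = B' v u)
    (hnd : B.Nondegenerate) (hnd' : B'.Nondegenerate)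
    {k : ℕ} {𝒱 : ℕ → Submodule F V} {𝒱' : ℕ → Submodule F V'}
    (hmono : ∀ i < k, 𝒱 i ≤ 𝒱 (i + 1)) (hmono' : ∀ i < k, 𝒱' i ≤ 𝒱' (i + 1))
    (hsd : ∀ i ≤ k, B.orthogonal (𝒱 i) = 𝒱 (k - i))
    (hsd' : ∀ i ≤ k, B'.orthogonal (𝒱' i) = 𝒱' (k - i))
    {E : Submodule F V} {E' : Submodule F V'}
    (h1 : ∀ i ≤ k, SubIsometric B B' (E ⊓ 𝒱 i) (E' ⊓ 𝒱' i))
    (h2 : ∀ i j : ℕ, k - i < j → j < i → i ≤ k →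
      finrank F ↥(B.orthogonal (E ⊓ 𝒱 i) ⊓ (E ⊓ 𝒱 j)) =
        finrank F ↥(B'.orthogonal (E' ⊓ 𝒱' i) ⊓ (E' ⊓ 𝒱' j)))
    {i j : ℕ} (hi : i ≤ k) (hj : j ≤ k) :
    finrank F ↥(E ⊓ 𝒱 j ⊓ B.orthogonal (E ⊓ 𝒱 i)) =
      finrank F ↥(E' ⊓ 𝒱' j ⊓ B'.orthogonal (E' ⊓ 𝒱' i)) := by
  have hle : ∀ i ≤ k, ∀ j ≤ i, finrank F ↥(E ⊓ 𝒱 j ⊓ B.orthogonal (E ⊓ 𝒱 i)) =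
      finrank F ↥(E' ⊓ 𝒱' j ⊓ B'.orthogonal (E' ⊓ 𝒱' i)) := by
    intro i hi j hji
    rcases eq_or_lt_of_le hji with rfl | hlt
    · exact (h1 j hi).finrank_radical_eq
    rcases lt_or_ge (k - i) j with hj | hj
    · rw [inf_comm, inf_comm (E' ⊓ 𝒱' j)]
      exact h2 i j hj hlt hi
    · have e : E ⊓ 𝒱 j ≤ B.orthogonal (E ⊓ 𝒱 i) := by
        refine inf_le_right.trans ((flag_le hmono hj (Nat.sub_le _ _)).trans ?_)
        rw [← hsd i hi]
        exact LinearMap.BilinForm.orthogonal_le inf_le_right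
      have e' : E' ⊓ 𝒱' j ≤ B'.orthogonal (E' ⊓ 𝒱' i) := by
        refine inf_le_right.trans ((flag_le hmono' hj (Nat.sub_le _ _)).trans ?_)
        rw [← hsd' i hi]
        exact LinearMap.BilinForm.orthogonal_le inf_le_right
      rw [inf_eq_left.2 e, inf_eq_left.2 e']
      exact (h1 j (by omega)).finrank_eq
  rcases le_total j i with h | h
  · exact hle i hi j h
  · have e1 := finrank_inf_orthogonal_add hB hnd (E ⊓ 𝒱 j) (E ⊓ 𝒱 i)
    have e2 := finrank_inf_orthogonal_add hB' hnd' (E' ⊓ 𝒱' j) (E' ⊓ 𝒱' i)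
    have e3 := hle j hj i h
    have e4 := (h1 i hi).finrank_eq
    have e5 := (h1 j hj).finrank_eq
    omega

end Isometry

end Witt

/-- Theorem 6.2: simultaneous isometry of (subspace, self-dual flag) pairs.
With `E_i := E ∩ V_i` and `E_i' := E' ∩ V_i'`, there exists an isometry
`φ_V : V → V'` sending `E` to `E'` and `𝒱` to `𝒱'` iff `E_i ≈ E_i'` for
`i = 1,…,k` and `dim(E_i^⊥ ∩ E_j) = dim(E_i'^⊥ ∩ E_j')` for
`k − i < j < i ≤ k`. -/
theorem witt_subspace_selfdual_flag_pair {F V V' : Type*} [Field F]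
    [AddCommGroup V] [Module F V] [AddCommGroup V'] [Module F V']
    [FiniteDimensional F V] [FiniteDimensional F V']
    (hchar : (2 : F) ≠ 0)
    (B : LinearMap.BilinForm F V) (B' : LinearMap.BilinForm F V')
    (hB : ∀ u v : V, B u v = B v u) (hB' : ∀ u v : V', B' u v = B' v u)
    (hnd : B.Nondegenerate) (hnd' : B'.Nondegenerate)
    (k : ℕ) (𝒱 : ℕ → Submodule F V) (𝒱' : ℕ → Submodule F V')
    (h0 : 𝒱 0 = ⊥) (hk : 𝒱 k = ⊤) (hmono : ∀ i < k, 𝒱 i ≤ 𝒱 (i + 1))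
    (h0' : 𝒱' 0 = ⊥) (hk' : 𝒱' k = ⊤) (hmono' : ∀ i < k, 𝒱' i ≤ 𝒱' (i + 1))
    (hsd : ∀ i ≤ k, B.orthogonal (𝒱 i) = 𝒱 (k - i))
    (hsd' : ∀ i ≤ k, B'.orthogonal (𝒱' i) = 𝒱' (k - i))
    (hflags : ∃ ψ : V ≃ₗ[F] V', IsIsometry B B' ψ ∧
      ∀ i ≤ k, (𝒱 i).map ψ.toLinearMap = 𝒱' i)
    (E : Submodule F V) (E' : Submodule F V') :
    (∃ φV : V ≃ₗ[F] V', IsIsometry B B' φV ∧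
        E.map φV.toLinearMap = E' ∧
        ∀ i ≤ k, (𝒱 i).map φV.toLinearMap = 𝒱' i) ↔
      ((∀ i, 1 ≤ i → i ≤ k →
          SubIsometric B B' (E ⊓ 𝒱 i) (E' ⊓ 𝒱' i)) ∧
       (∀ i j : ℕ, k - i < j → j < i → i ≤ k →
         finrank F ↥(B.orthogonal (E ⊓ 𝒱 i) ⊓ (E ⊓ 𝒱 j)) =
           finrank F ↥(B'.orthogonal (E' ⊓ 𝒱' i) ⊓ (E' ⊓ 𝒱' j)))) := by
  have hle := fun {i j : ℕ} => flag_le hmono (i := i) (j := j)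
  have hle' := fun {i j : ℕ} => flag_le hmono' (i := i) (j := j)
  constructor
  · rintro ⟨φ, hφ, rfl, hφV⟩
    have hpres : PreservesOn B B' φ.toLinearMap ⊤ := fun u _ v _ => hφ u v
    have hinj : ∀ u ∈ (⊤ : Submodule F V), φ.toLinearMap u = 0 → u = 0 := fun u _ hu => by
      simpa using hu
    have hmap : ∀ i ≤ k, (E ⊓ 𝒱 i).map φ.toLinearMap = E.map φ.toLinearMap ⊓ 𝒱' i := by
      intro i hi
      rw [Submodule.map_inf _ φ.injective, hφV i hi]
    refine ⟨fun i _ hi => ?_, fun i j _ hji hi => ?_⟩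
    · rw [← hmap i hi]
      exact SubIsometric.of_linearMap (fun u _ v _ => hφ u v)
        (fun u hu => Submodule.mem_map_of_mem hu) (fun u _ => hinj u trivial)
        (finrank_map_of_inj fun u _ => hinj u trivial).symm
    · rw [← hmap i hi, ← hmap j (by omega), inf_comm, inf_comm (B'.orthogonal _)]
      exact hpres.finrank_inf_orthogonal_eq hinj le_top le_top
  · rintro ⟨h1, h2⟩
    have h1' : ∀ i ≤ k, SubIsometric B B' (E ⊓ 𝒱 i) (E' ⊓ 𝒱' i) := by
      intro i hi
      rcases Nat.eq_zero_or_pos i with rfl | hpos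
      · rw [h0, h0', inf_bot_eq, inf_bot_eq]
        exact SubIsometric.of_linearMap (f := 0)
          (fun u hu v _ => by simp [(Submodule.mem_bot F).1 hu]) (fun u _ => Submodule.zero_mem _)
          (fun u hu _ => (Submodule.mem_bot F).1 hu) (by simp)
      · exact h1 i hpos hi
    obtain ⟨ψ, hψ, hψV⟩ := hflags
    have hlast : (⊤ : Fin (k + 1)).val = k := rfl
    obtain ⟨f, hf, hfmap⟩ := exists_preservesOn_map_eq (ι := Fin (k + 1)) hchar hB hB' _
      (fun i => E ⊓ 𝒱 i.val) (fun i => E' ⊓ 𝒱' i.val)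
      (fun i j hij => inf_le_inf_left _ (hle hij (by omega)))
      (fun i j hij => inf_le_inf_left _ (hle' hij (by omega)))
      (fun i => h1' i.val (by omega))
      (fun i j => finrank_inf_flag_inf_orthogonal_eq hB hB' hnd hnd' hmono hmono' hsd hsd' h1' h2
        (by omega) (by omega)) rfl
    have hfE : E.map f = E' := by simpa [hlast, hk, hk'] using hfmap ⊤
    have hf' : PreservesOn B B' f E := by simpa [hlast, hk] using hf
    have hrank : finrank F E = finrank F E' := by
      have h := (h1' k le_rfl).finrank_eq
      rwa [hk, hk', inf_top_eq, inf_top_eq] at h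
    have hfV : ∀ i ≤ k, (E ⊓ 𝒱 i).map f = E' ⊓ 𝒱' i := fun i hi =>
      hfmap ⟨i, Nat.lt_succ_of_le hi⟩
    have hfinj : ∀ u ∈ E, ∀ v ∈ E, f u = f v → u = v := by
      have hi : Function.Injective (f.domRestrict E) := by
        rw [← LinearMap.ker_eq_bot, ← Submodule.finrank_eq_zero (R := F)]
        have := LinearMap.finrank_range_add_finrank_ker (f.domRestrict E)
        rw [LinearMap.range_domRestrict, hfE] at this
        omega
      exact fun u hu v hv huv => congrArg Subtype.val (@hi ⟨u, hu⟩ ⟨v, hv⟩ huv)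
    have hfl : ∀ i ≤ k, ∀ u ∈ E, (f u ∈ 𝒱' i ↔ u ∈ 𝒱 i) := by
      intro i hi u hu
      constructor
      · intro h
        have hmem : f u ∈ E' ⊓ 𝒱' i := ⟨hfE ▸ Submodule.mem_map_of_mem hu, h⟩
        rw [← hfV i hi] at hmem
        obtain ⟨v, hv, hvu⟩ := hmem
        rw [← hfinj v hv.1 u hu hvu]
        exact hv.2
      · intro h
        have hmem : f u ∈ (E ⊓ 𝒱 i).map f := Submodule.mem_map_of_mem ⟨hu, h⟩
        rw [hfV i hi] at hmem
        exact hmem.2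
    have hψl : ∀ i ≤ k, ∀ v, (ψ.symm v ∈ 𝒱 i ↔ v ∈ 𝒱' i) := by
      intro i hi v
      rw [← hψV i hi]
      exact (Submodule.mem_map_equiv ..).symm
    have hψs : ∀ u v, B (ψ.symm u) (ψ.symm v) = B' u v := fun u v => by
      simpa using (hψ (ψ.symm u) (ψ.symm v)).symm
    have hfp : FlagPreservesOn B 𝒱 k (ψ.symm.toLinearMap ∘ₗ f) E :=
      ⟨fun u hu v hv => (hψs _ _).trans (hf' u hu v hv),
        fun i hi u hu => (hψl i hi _).trans (hfl i hi u hu)⟩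
    obtain ⟨g, hg, hgE⟩ := hfp.exists_extend hchar hB hnd h0 hk hmono hsd E
    have hginj : Function.Injective g := (injective_iff_map_eq_zero g).2 fun u =>
      hg.eq_zero h0 u trivial
    let φ : V ≃ₗ[F] V' := (LinearEquiv.ofInjectiveEndo g hginj).trans ψ
    have hφ : ∀ u, φ u = ψ (g u) := fun u => rfl
    refine ⟨φ, fun u v => (hψ _ _).trans (hg.1 u trivial v trivial), ?_, fun i hi => ?_⟩
    · rw [← hfE]
      refine SetLike.coe_injective ?_
      simp only [Submodule.map_coe]
      refine Set.image_congr fun u hu => ?_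
      change ψ (g u) = f u
      rw [hgE u hu]
      exact ψ.apply_symm_apply _
    · rw [← hψV i hi]
      have hgV : (𝒱 i).map g = 𝒱 i := map_eq_of_finrank_eq
        (fun u hu => (hg.2 i hi u trivial).2 hu) (fun u _ => hg.eq_zero h0 u trivial) rfl
      conv_rhs => rw [← hgV, ← Submodule.map_comp]
      rfl
end

section
/- Let (V,b) ≈ (V',b') be nonsingular finite-dimensional metric spaces over F. Let E, A ⊆ V and E', A' ⊆ V' be subspaces with A and A' totally isotropic, A ≈ A', and E ≈ E'. Then there exists an isometry φ_V : V → V' with φ_V(E) = E' and φ_V(A) = A' if and only if E ∩ A^⊥ ≈ E' ∩ A'^⊥, dim(E ∩ A) = dim(E' ∩ A'), dim(E^⊥ ∩ E ∩ A) = dim(E'^⊥ ∩ E' ∩ A'), and dim(E^⊥ ∩ E ∩ A^⊥) = dim(E'^⊥ ∩ E' ∩ A'^⊥). -/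
open Module

namespace Witt

variable {F V V' : Type*} [Field F] [AddCommGroup V] [Module F V]
  [AddCommGroup V'] [Module F V']

theorem exists_mem_orthogonal_apply_eq_one [FiniteDimensional F V]
    {B : LinearMap.BilinForm F V} (hB : ∀ u v, B u v = B v u) (hnd : B.Nondegenerate)
    {N : Submodule F V} {x : V} (hx : x ∉ N) :
    ∃ u, (∀ n ∈ N, B u n = 0) ∧ B u x = 1 := by
  have hr : B.IsRefl := fun u v h => by rw [hB, h]
  rw [← LinearMap.BilinForm.orthogonal_orthogonal hnd hr N,
    LinearMap.BilinForm.mem_orthogonal_iff] at hx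
  push Not at hx
  obtain ⟨u, hu, hux⟩ := hx
  have hux' : B u x ≠ 0 := hux
  refine ⟨(B u x)⁻¹ • u, fun n hn => ?_, by simp [hux']⟩
  have h : B n u = 0 := hu n hn
  simp [hB u n, h]

/-- Two vectors of equal length having the same products with `N` and lying outside `N` are
conjugate under an isometry fixing `N` pointwise. -/
theorem exists_isometry_fixing_and_apply_eq [FiniteDimensional F V] (hchar : (2 : F) ≠ 0)
    {B : LinearMap.BilinForm F V} (hB : ∀ u v, B u v = B v u) (hnd : B.Nondegenerate)
    {N : Submodule F V} {x y : V} (hx : x ∉ N) (hy : y ∉ N)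
    (hxy : ∀ n ∈ N, B y n = B x n) (hq : B y y = B x x) :
    ∃ g : V →ₗ[F] V, (∀ u v, B (g u) (g v) = B u v) ∧ (∀ n ∈ N, g n = n) ∧ g x = y := by
  obtain ⟨w, hw⟩ : ∃ w, w = x - y := ⟨_, rfl⟩
  have hwN : ∀ n ∈ N, B w n = 0 := fun n hn => by simp [hw, hxy n hn]
  have hwx : 2 * B w x = B w w := by
    simp only [hw, map_sub, LinearMap.sub_apply, hB x y, hq]; ring
  obtain rfl : y = x - w := by rw [hw]; abel
  clear hw
  by_cases hww : B w w = 0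
  · have hwx0 : B w x = 0 := by
      rw [hww] at hwx; exact (mul_eq_zero.mp hwx).resolve_left hchar
    by_cases hxs : x ∈ N ⊔ Submodule.span F {w}
    · obtain ⟨n, hn, z, hz, hnz⟩ := Submodule.mem_sup.mp hxs
      obtain ⟨c, rfl⟩ := Submodule.mem_span_singleton.mp hz
      have hwN' : w ∉ N := fun h => hx (hnz ▸ N.add_mem hn (N.smul_mem c h))
      have hc : c ≠ 0 := by
        rintro rfl
        exact hx (by simpa [← hnz] using hn)
      have hc1 : c - 1 ≠ 0 := by
        intro h
        obtain rfl : c = 1 := sub_eq_zero.mp h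
        exact hy (by simpa [← hnz] using hn)
      obtain ⟨u₀, hu₀, hu₀w⟩ := exists_mem_orthogonal_apply_eq_one hB hnd hwN'
      obtain ⟨u, hu⟩ : ∃ u, u = u₀ - (B u₀ u₀ / 2) • w := ⟨_, rfl⟩
      have huN : ∀ n ∈ N, B u n = 0 := fun n hn => by simp [hu, hu₀ n hn, hwN n hn]
      have huw : B u w = 1 := by simp [hu, hu₀w, hww]
      have huu : B u u = 0 := by
        simp only [hu, map_sub, LinearMap.sub_apply, map_smul, LinearMap.smul_apply, smul_eq_mul,
          hB w u₀, hu₀w, hww]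
        field_simp; ring
      have hux : B u x = c := by simp [← hnz, huN n hn, huw]
      refine ⟨LinearMap.id + (B u).smulRight (((c - 1) / c - 1) • w) +
        (B w).smulRight ((c / (c - 1) - 1) • u), fun a b => ?_, fun m hm => ?_, ?_⟩
      · simp only [LinearMap.add_apply, LinearMap.id_apply, LinearMap.smulRight_apply, map_add,
          map_smul, LinearMap.smul_apply, smul_eq_mul, huu, hww, huw, hB w u, hB a u, hB a w]
        field_simp; ring
      · simp [huN m hm, hwN m hm]
      · simp only [LinearMap.add_apply, LinearMap.id_apply, LinearMap.smulRight_apply, hux, hwx0,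
          smul_smul]
        rw [show c * ((c - 1) / c - 1) = -1 by field_simp; ring]
        simp only [zero_mul, zero_smul]
        module
    · obtain ⟨u, hu, hux⟩ := exists_mem_orthogonal_apply_eq_one hB hnd hxs
      have huN : ∀ n ∈ N, B u n = 0 := fun n hn => hu n (Submodule.mem_sup_left hn)
      have huw : B u w = 0 := hu w (Submodule.mem_sup_right (Submodule.mem_span_singleton_self w))
      refine ⟨LinearMap.id + (B w).smulRight (u - (B u u / 2) • w) - (B u).smulRight w,
        fun a b => ?_, fun m hm => ?_, ?_⟩
      · simp only [LinearMap.add_apply, LinearMap.sub_apply, LinearMap.id_apply, map_sub,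
          LinearMap.smulRight_apply, map_add,
          map_smul, LinearMap.smul_apply, smul_eq_mul, hww, huw, hB w u, hB a u, hB a w]
        field_simp; ring
      · simp [huN m hm, hwN m hm]
      · simp [hux, hwx0]
  · have h2 : B w x * (2 / B w w) = 1 := by rw [← hwx] at hww ⊢; field_simp [right_ne_zero_of_mul hww]
    refine ⟨LinearMap.id - (B w).smulRight ((2 / B w w) • w), fun a b => ?_, fun m hm => ?_, ?_⟩
    · simp only [LinearMap.sub_apply, LinearMap.id_apply, map_sub, LinearMap.smulRight_apply,
        map_smul, LinearMap.smul_apply, smul_eq_mul, hB a w]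
      field_simp; ring
    · simp [hwN m hm]
    · simp only [LinearMap.sub_apply, LinearMap.id_apply, LinearMap.smulRight_apply, smul_smul, h2,
        one_smul]

theorem eq_zero_of_isometry {B : LinearMap.BilinForm F V} {B' : LinearMap.BilinForm F V'}
    (hnd : B.Nondegenerate) {g : V →ₗ[F] V'}
    (hg : ∀ u v, B' (g u) (g v) = B u v) {u : V} (hu : g u = 0) : u = 0 :=
  hnd.1 u fun v => by rw [← hg, hu]; simp

/-- Witt's extension theorem inside a nonsingular space. -/
theorem exists_isometry_extending_end [FiniteDimensional F V] (hchar : (2 : F) ≠ 0)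
    {B : LinearMap.BilinForm F V} (hB : ∀ u v, B u v = B v u) (hnd : B.Nondegenerate)
    (N : Submodule F V) (f : V →ₗ[F] V) (hf : ∀ u ∈ N, ∀ v ∈ N, B (f u) (f v) = B u v)
    (hinj : ∀ u ∈ N, f u = 0 → u = 0) :
    ∃ g : V →ₗ[F] V, (∀ u v, B (g u) (g v) = B u v) ∧ ∀ u ∈ N, g u = f u := by
  classical
  obtain ⟨s, rfl⟩ := IsNoetherian.noetherian N
  induction s using Finset.induction_on with
  | empty =>
    refine ⟨LinearMap.id, fun _ _ => rfl, fun u hu => ?_⟩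
    obtain rfl : u = 0 := by simpa using hu
    simp
  | insert x s _ ih =>
    rw [Finset.coe_insert, Submodule.span_insert] at *
    set N := Submodule.span F (s : Set V)
    have hxm : x ∈ Submodule.span F {x} ⊔ N :=
      Submodule.mem_sup_left (Submodule.mem_span_singleton_self x)
    have hNm : ∀ n ∈ N, n ∈ Submodule.span F {x} ⊔ N := fun n => Submodule.mem_sup_right
    obtain ⟨g₁, hg₁, hgf⟩ := ih (fun u hu v hv => hf u (hNm u hu) v (hNm v hv))
      fun u hu => hinj u (hNm u hu)
    by_cases hx : x ∈ N
    · refine ⟨g₁, hg₁, fun u hu => hgf u ?_⟩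
      rwa [sup_eq_right.mpr (by simpa using hx)] at hu
    let e := LinearEquiv.ofInjectiveEndo g₁
      ((injective_iff_map_eq_zero g₁).mpr fun u hu => eq_zero_of_isometry hnd hg₁ hu)
    have he : ∀ v, g₁ (e.symm v) = v := fun v => e.apply_symm_apply v
    have hy : e.symm (f x) ∉ N := fun h => hx <| by
      have h1 := hgf _ h
      rw [he] at h1
      have h2 := hinj (x - e.symm (f x)) (Submodule.sub_mem _ hxm (hNm _ h))
        (by rw [map_sub, ← h1, sub_self])
      rwa [sub_eq_zero.mp h2]
    obtain ⟨g₂, hg₂, hg₂N, hg₂x⟩ := exists_isometry_fixing_and_apply_eq hchar hB hnd hx hy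
      (fun n hn => by rw [← hg₁, he, hgf n hn, hf x hxm n (hNm n hn)])
      (by rw [← hg₁, he, hf x hxm x hxm])
    refine ⟨g₁ ∘ₗ g₂, fun u v => by simp [hg₁, hg₂], fun u hu => ?_⟩
    obtain ⟨z, hz, n, hn, rfl⟩ := Submodule.mem_sup.mp hu
    obtain ⟨c, rfl⟩ := Submodule.mem_span_singleton.mp hz
    simp [hg₂x, hg₂N n hn, he, hgf n hn]

theorem exists_disjoint_sup_eq {S X : Submodule F V} (h : S ≤ X) :
    ∃ C ≤ X, Disjoint S C ∧ S ⊔ C = X := by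
  obtain ⟨C, hC⟩ := Submodule.exists_isCompl S
  refine ⟨C ⊓ X, inf_le_right, hC.disjoint.mono_right inf_le_left, ?_⟩
  rw [← sup_inf_assoc_of_le C h, hC.sup_eq_top, top_inf_eq]

/-- Two linear maps agreeing on `S ⊓ T` can be glued along `S` and `T`. -/
theorem exists_linearMap_glue {S T : Submodule F V} (f₁ f₂ : V →ₗ[F] V')
    (h : ∀ u ∈ S, u ∈ T → f₁ u = f₂ u) :
    ∃ g : V →ₗ[F] V', (∀ u ∈ S, g u = f₁ u) ∧ ∀ u ∈ T, g u = f₂ u := by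
  obtain ⟨C, hCT, hdis, hsup⟩ := exists_disjoint_sup_eq (inf_le_right : S ⊓ T ≤ T)
  have hSC : Disjoint S C := by
    rw [Submodule.disjoint_def] at hdis ⊢
    exact fun x hx hxC => hdis x ⟨hx, hCT hxC⟩ hxC
  obtain ⟨D, hSD, hD⟩ := hSC.exists_isCompl
  let g := LinearMap.ofIsCompl hD (f₁.domRestrict D) (f₂.domRestrict C)
  have hg₁ : ∀ u ∈ S, g u = f₁ u := fun u hu =>
    LinearMap.ofIsCompl_apply_left hD (⟨u, hSD hu⟩ : D)
  have hg₂ : ∀ u ∈ C, g u = f₂ u := fun u hu =>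
    LinearMap.ofIsCompl_apply_right hD (⟨u, hu⟩ : C)
  refine ⟨g, hg₁, fun u hu => ?_⟩
  rw [← hsup] at hu
  obtain ⟨s, hs, c, hc, rfl⟩ := Submodule.mem_sup.mp hu
  rw [map_add, map_add, hg₁ s hs.1, hg₂ c hc, h s hs.1 hs.2]

theorem finrank_map_of_injOn {X : Submodule F V} (f : V →ₗ[F] V')
    (hinj : ∀ u ∈ X, f u = 0 → u = 0) : finrank F (X.map f) = finrank F X := by
  rw [← LinearMap.range_domRestrict]
  refine LinearMap.finrank_range_of_inj ((injective_iff_map_eq_zero _).mpr fun u hu => ?_)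
  exact Subtype.ext (hinj u u.2 hu)

theorem map_eq_of_injOn_of_finrank_eq [FiniteDimensional F V'] {X : Submodule F V}
    {Y : Submodule F V'} (f : V →ₗ[F] V') (hmaps : ∀ u ∈ X, f u ∈ Y)
    (hinj : ∀ u ∈ X, f u = 0 → u = 0) (hd : finrank F X = finrank F Y) : X.map f = Y :=
  Submodule.eq_of_le_of_finrank_eq (Submodule.map_le_iff_le_comap.mpr hmaps)
    (by rw [finrank_map_of_injOn f hinj, hd])

/-- An injective linear map `S → Y` extends to a bijection `X → Y` if `S ≤ X` and `X`, `Y` have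
equal dimension. -/
theorem exists_injOn_extension [FiniteDimensional F V] [FiniteDimensional F V']
    {S X : Submodule F V} {Y : Submodule F V'} (hS : S ≤ X) (f : V →ₗ[F] V')
    (hmaps : ∀ u ∈ S, f u ∈ Y) (hinj : ∀ u ∈ S, f u = 0 → u = 0)
    (hd : finrank F X = finrank F Y) :
    ∃ g : V →ₗ[F] V', (∀ u ∈ S, g u = f u) ∧ (∀ u ∈ X, g u ∈ Y) ∧ ∀ u ∈ X, g u = 0 → u = 0 := by
  obtain ⟨C, hCX, hC, hCsup⟩ := exists_disjoint_sup_eq hS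
  obtain ⟨D, hDY, hD, hDsup⟩ := exists_disjoint_sup_eq (Submodule.map_le_iff_le_comap.mpr hmaps)
  have hCD : finrank F C = finrank F D := by
    have h1 := Submodule.finrank_sup_add_finrank_inf_eq S C
    have h2 := Submodule.finrank_sup_add_finrank_inf_eq (S.map f) D
    rw [hC.eq_bot, finrank_bot, hCsup] at h1
    rw [hD.eq_bot, finrank_bot, hDsup, finrank_map_of_injOn f hinj] at h2
    omega
  let e := LinearEquiv.ofFinrankEq C D hCD
  obtain ⟨k, hk⟩ := LinearMap.exists_extend (D.subtype ∘ₗ e.toLinearMap)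
  have hk' : ∀ c (hc : c ∈ C), k c = e ⟨c, hc⟩ := fun c hc => LinearMap.congr_fun hk ⟨c, hc⟩
  rw [Submodule.disjoint_def] at hC hD
  obtain ⟨g, hgS, hgC⟩ := exists_linearMap_glue (S := S) (T := C) f k fun u hu huC => by
    simp [hC u hu huC]
  refine ⟨g, hgS, fun u hu => ?_, fun u hu h0 => ?_⟩
  · rw [← hCsup] at hu
    obtain ⟨s, hs, c, hc, rfl⟩ := Submodule.mem_sup.mp hu
    rw [map_add, hgS s hs, hgC c hc, hk' c hc]
    exact Y.add_mem (hmaps s hs) (hDY (e _).2)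
  · rw [← hCsup] at hu
    obtain ⟨s, hs, c, hc, rfl⟩ := Submodule.mem_sup.mp hu
    rw [map_add, hgS s hs, hgC c hc, hk' c hc] at h0
    have hfs : f s = 0 := hD _ (Submodule.mem_map_of_mem hs)
      (by rw [eq_neg_of_add_eq_zero_left h0]; exact D.neg_mem (e _).2)
    rw [hfs, zero_add] at h0
    have hc0 : (⟨c, hc⟩ : C) = 0 := e.map_eq_zero_iff.mp (Subtype.ext h0)
    rw [hinj s hs hfs, show c = 0 from congrArg Subtype.val hc0, add_zero]

/-- Witt's extension theorem inside a possibly singular space with radical `ker B`. -/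
theorem exists_isometry_extending_of_ker [FiniteDimensional F V] (hchar : (2 : F) ≠ 0)
    {B : LinearMap.BilinForm F V} (hB : ∀ u v, B u v = B v u)
    (N : Submodule F V) (f : V →ₗ[F] V) (hf : ∀ u ∈ N, ∀ v ∈ N, B (f u) (f v) = B u v)
    (hinj : ∀ u ∈ N, f u = 0 → u = 0)
    (hker : ∀ u ∈ N, f u ∈ LinearMap.ker B ↔ u ∈ LinearMap.ker B) :
    ∃ g : V →ₗ[F] V, (∀ u v, B (g u) (g v) = B u v) ∧ (∀ u, g u = 0 → u = 0) ∧
      ∀ u ∈ N, g u = f u := by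
  obtain ⟨R, hR⟩ : ∃ R, R = LinearMap.ker B := ⟨_, rfl⟩
  rw [← hR] at hker
  have hRl : ∀ r ∈ R, ∀ v, B r v = 0 := fun r hr v => by
    rw [hR, LinearMap.mem_ker] at hr; simp [hr]
  have hRr : ∀ r ∈ R, ∀ v, B v r = 0 := fun r hr v => by rw [hB, hRl r hr]
  obtain ⟨N₁, hN₁N, hN₁, hN₁sup⟩ := exists_disjoint_sup_eq (inf_le_left : N ⊓ R ≤ N)
  have hN₁R : Disjoint N₁ R := by
    rw [Submodule.disjoint_def] at hN₁ ⊢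
    exact fun x hx hxR => hN₁ x ⟨hN₁N hx, hxR⟩ hx
  obtain ⟨E, hNE, hE⟩ := hN₁R.exists_isCompl
  have hER := Submodule.disjoint_def.mp hE.disjoint
  obtain ⟨p, hpE, hpR⟩ := exists_linearMap_glue (S := E) (T := R) LinearMap.id
    (0 : V →ₗ[F] V) fun u hu huR => hER u hu huR
  have hp : ∀ u, p u ∈ E ∧ u - p u ∈ R := fun u => by
    obtain ⟨e, he, r, hr, rfl⟩ := Submodule.mem_sup.mp (hE.sup_eq_top ▸ Submodule.mem_top (x := u))
    simpa [hpE e he, hpR r hr] using ⟨he, hr⟩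
  have hBp : ∀ u v, B (p u) (p v) = B u v := fun u v => by
    have h1 := hRl _ (hp u).2 v
    have h2 := hRr _ (hp v).2 (p u)
    rw [map_sub, LinearMap.sub_apply] at h1
    rw [map_sub] at h2
    linear_combination -h1 - h2
  have hpp : ∀ u, p u = 0 ↔ u ∈ R :=
    fun u => ⟨fun h => by simpa [h] using (hp u).2, hpR u⟩
  let q : V →ₗ[F] E := p.codRestrict E fun u => (hp u).1
  have hnd : (B.restrict E).Nondegenerate := by
    have key : ∀ e : E, (∀ e' : E, B e e' = 0) → e = 0 := fun e he => by
      refine Subtype.ext (hER e e.2 ?_)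
      rw [hR, LinearMap.mem_ker]
      ext v
      rw [← hBp, hpE e e.2]
      exact he ⟨p v, (hp v).1⟩
    exact ⟨key, fun e he => key e fun e' => by rw [hB]; exact he e'⟩
  obtain ⟨g₀, hg₀, hg₀f⟩ := exists_isometry_extending_end (B := B.restrict E) hchar
    (fun u v => hB u v) hnd (N₁.comap E.subtype) (q ∘ₗ f ∘ₗ E.subtype)
    (fun u hu v hv => (hBp _ _).trans (hf u (hN₁N hu) v (hN₁N hv)))
    (fun u hu h0 => Subtype.ext <| hER u u.2 <| (hker u (hN₁N hu)).mp <|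
      (hpp _).mp (congrArg Subtype.val h0))
  obtain ⟨a, ha, haR, hainj⟩ := exists_injOn_extension (S := N ⊓ R) (X := R) (Y := R) inf_le_right f
    (fun u hu => (hker u hu.1).mpr hu.2) (fun u hu => hinj u hu.1) rfl
  let g : V →ₗ[F] V := E.subtype ∘ₗ g₀ ∘ₗ q + (LinearMap.id - p) ∘ₗ f ∘ₗ p +
    a ∘ₗ (LinearMap.id - p)
  have hg : ∀ u, g u = g₀ (q u) + ((f (p u) - p (f (p u))) + a (u - p u)) := fun u => by
    simp [g, add_assoc]
  have hgR : ∀ u, (f (p u) - p (f (p u))) + a (u - p u) ∈ R := fun u =>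
    R.add_mem (hp _).2 (haR _ (hp u).2)
  refine ⟨g, fun u v => ?_, fun u h0 => ?_, fun u hu => ?_⟩
  · rw [hg, hg, ← hBp u v, map_add B, LinearMap.add_apply, map_add (B _), hRl _ (hgR u),
      hRr _ (hgR v), add_zero, add_zero]
    exact hg₀ _ _
  · have h1 : (g₀ (q u) : V) = 0 := by
      refine hER _ (g₀ _).2 ?_
      rw [hg] at h0
      rw [eq_neg_of_add_eq_zero_left h0]
      exact R.neg_mem (hgR u)
    have h2 : p u = 0 := congrArg Subtype.val (eq_zero_of_isometry hnd hg₀ (Subtype.ext h1))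
    rw [hg, h1, h2] at h0
    exact hainj u ((hpp u).mp h2) (by simpa using h0)
  · rw [← hN₁sup] at hu
    obtain ⟨r, hr, n, hn, rfl⟩ := Submodule.mem_sup.mp hu
    have hpn : p (r + n) = n := by rw [map_add, hpR r hr.2, hpE n (hNE hn)]; simp
    have hqn : q (r + n) = ⟨n, hNE hn⟩ := Subtype.ext hpn
    rw [hg, hqn, hpn, add_sub_cancel_right, ha r hr, hg₀f ⟨n, hNE hn⟩ hn]
    simp only [q, LinearMap.comp_apply, Submodule.subtype_apply, LinearMap.codRestrict_apply, map_add]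
    abel

/-- Let `I` and `I'` be contained in the radicals of subspaces `M`, `M'` of a possibly singular
space. An isometry `M → M'` can be modified into an isometry of the whole space
matching `M` with `M'` and `I` with `I'`, provided the dimensions of `I`, `I ⊓ ker B` and
`M ⊓ ker B` agree with those of their counterparts. -/
theorem exists_isometry_mapsTo_mapsTo [FiniteDimensional F V] (hchar : (2 : F) ≠ 0)
    {B : LinearMap.BilinForm F V} (hB : ∀ u v, B u v = B v u)
    {M M' I I' : Submodule F V} (hIM : I ≤ M ⊓ B.orthogonal M) (hIM' : I' ≤ M' ⊓ B.orthogonal M')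
    (s : V →ₗ[F] V) (hs : ∀ u ∈ M, ∀ v ∈ M, B (s u) (s v) = B u v) (hsM : ∀ u ∈ M, s u ∈ M')
    (hsinj : ∀ u ∈ M, s u = 0 → u = 0) (hM : finrank F M = finrank F M')
    (hI : finrank F I = finrank F I')
    (hIR : finrank F ↥(I ⊓ LinearMap.ker B) = finrank F ↥(I' ⊓ LinearMap.ker B))
    (hMR : finrank F ↥(M ⊓ LinearMap.ker B) = finrank F ↥(M' ⊓ LinearMap.ker B)) :
    ∃ g : V →ₗ[F] V, (∀ u v, B (g u) (g v) = B u v) ∧ (∀ u, g u = 0 → u = 0) ∧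
      (∀ u ∈ M, g u ∈ M') ∧ ∀ u ∈ I, g u ∈ I' := by
  have hMs : M.map s = M' := map_eq_of_injOn_of_finrank_eq s hsM hsinj hM
  obtain ⟨Q, hQ⟩ : ∃ Q, Q = M ⊓ B.orthogonal M := ⟨_, rfl⟩
  obtain ⟨Q', hQ'⟩ : ∃ Q', Q' = M' ⊓ B.orthogonal M' := ⟨_, rfl⟩
  obtain ⟨R, hR⟩ : ∃ R, R = LinearMap.ker B := ⟨_, rfl⟩
  have hRr : ∀ r ∈ R, ∀ v, B v r = 0 := fun r hr v => by
    rw [hR, LinearMap.mem_ker] at hr; simp [hB v, hr]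
  rw [← hQ] at hIM
  rw [← hQ'] at hIM'
  rw [← hR] at hIR hMR
  have hQM : Q ≤ M := hQ ▸ inf_le_left
  have hQM' : Q' ≤ M' := hQ' ▸ inf_le_left
  have hMRQ : M ⊓ R ≤ Q := by
    rw [hQ]; exact fun u hu => ⟨hu.1, fun v _ => hRr u hu.2 v⟩
  have hMRQ' : M' ⊓ R ≤ Q' := by
    rw [hQ']; exact fun u hu => ⟨hu.1, fun v _ => hRr u hu.2 v⟩
  have hsQ : ∀ u ∈ M, s u ∈ Q' ↔ u ∈ Q := fun u hu => by
    rw [hQ, hQ']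
    refine ⟨fun h => ⟨hu, fun v hv => ?_⟩, fun h => ⟨hsM u hu, fun v' hv' => ?_⟩⟩
    · exact (hs v hv u hu).symm.trans (h.2 _ (hsM v hv))
    · rw [← hMs] at hv'
      obtain ⟨v, hv, rfl⟩ := hv'
      exact (hs v hv u hu).trans (h.2 v hv)
  have hQs : Q.map s = Q' := by
    refine le_antisymm (Submodule.map_le_iff_le_comap.mpr fun u hu => (hsQ u (hQM hu)).mpr hu) ?_
    intro v hv
    obtain ⟨u, hu, rfl⟩ := hMs.symm ▸ hQM' hv
    exact ⟨u, (hsQ u hu).mp hv, rfl⟩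
  have hQQ : finrank F Q = finrank F Q' := by
    rw [← hQs, finrank_map_of_injOn s fun u hu => hsinj u (hQM hu)]
  have hJI : I ⊓ R ≤ I := inf_le_left
  have hIleM : I ≤ M := hIM.trans hQM
  have hJP : I ⊓ R ≤ M ⊓ R := inf_le_inf_right R hIleM
  have hJP' : I' ⊓ R ≤ M' ⊓ R := inf_le_inf_right R (hIM'.trans hQM')
  obtain ⟨j, -, hjJ, hjinj⟩ := exists_injOn_extension (S := ⊥) (X := I ⊓ R) (Y := I' ⊓ R) bot_le
    (0 : V →ₗ[F] V) (by simp) (by simp) hIR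
  obtain ⟨a₁, ha₁, ha₁I, ha₁inj⟩ := exists_injOn_extension (S := I ⊓ R) (X := I) (Y := I') hJI j
    (fun u hu => (hjJ u hu).1) hjinj hI
  obtain ⟨a₂, ha₂, ha₂P, ha₂inj⟩ := exists_injOn_extension (S := I ⊓ R) (X := M ⊓ R) (Y := M' ⊓ R)
    hJP j (fun u hu => hJP' (hjJ u hu)) hjinj hMR
  obtain ⟨a, haI, haP⟩ := exists_linearMap_glue (S := I) (T := M ⊓ R) a₁ a₂ fun u hu hu' => by
    rw [ha₁ u ⟨hu, hu'.2⟩, ha₂ u ⟨hu, hu'.2⟩]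
  obtain ⟨r, hr, hrQ, hrinj⟩ := exists_injOn_extension (S := I ⊔ (M ⊓ R)) (X := Q) (Y := Q')
    (sup_le hIM hMRQ) a
    (fun u hu => by
      obtain ⟨i, hi, p, hp, rfl⟩ := Submodule.mem_sup.mp hu
      rw [map_add, haI i hi, haP p hp]
      exact Q'.add_mem (hIM' (ha₁I i hi)) (hMRQ' (ha₂P p hp)))
    (fun u hu h0 => by
      obtain ⟨i, hi, p, hp, rfl⟩ := Submodule.mem_sup.mp hu
      have h1 : a₁ i ∈ I' ⊓ R := by
        refine ⟨ha₁I i hi, ?_⟩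
        rw [map_add, haI i hi, haP p hp] at h0
        rw [eq_neg_of_add_eq_zero_left h0]
        exact R.neg_mem (ha₂P p hp).2
      rw [← map_eq_of_injOn_of_finrank_eq j hjJ hjinj hIR] at h1
      obtain ⟨i', hi', hii⟩ := h1
      have h2 : i = i' := sub_eq_zero.mp <| ha₁inj _ (I.sub_mem hi hi'.1) <| by
        rw [map_sub, ha₁ i' hi', hii, sub_self]
      have h3 : i + p ∈ M ⊓ R := (M ⊓ R).add_mem (h2 ▸ hJP hi') hp
      exact ha₂inj _ h3 (by rw [← haP _ h3, h0])) hQQ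
  obtain ⟨C, hCM, hC, hCsup⟩ := exists_disjoint_sup_eq hQM
  have hC := Submodule.disjoint_def.mp hC
  obtain ⟨h, hhQ, hhC⟩ := exists_linearMap_glue (S := Q) (T := C) r s fun u hu huC => by
    simp [hC u hu huC]
  have hdec : ∀ u ∈ M, ∃ q ∈ Q, ∃ c ∈ C, u = q + c ∧ h u = r q + s c := fun u hu => by
    rw [← hCsup] at hu
    obtain ⟨q, hq, c, hc, rfl⟩ := Submodule.mem_sup.mp hu
    exact ⟨q, hq, c, hc, rfl, by rw [map_add, hhQ q hq, hhC c hc]⟩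
  have hhM : ∀ u ∈ M, h u ∈ M' := fun u hu => by
    obtain ⟨q, hq, c, hc, -, h1⟩ := hdec u hu
    rw [h1]
    exact M'.add_mem (hQM' (hrQ q hq)) (hsM c (hCM hc))
  have hadd : ∀ N : Submodule F V, ∀ q ∈ N ⊓ B.orthogonal N, ∀ q' ∈ N ⊓ B.orthogonal N,
      ∀ c ∈ N, ∀ c' ∈ N, B (q + c) (q' + c') = B c c' := fun N q hq q' hq' c hc c' hc' => by
    have h1 : B q q' = 0 := hq'.2 q hq.1
    have h2 : B c q' = 0 := hq'.2 c hc
    have h3 : B c' q = 0 := hq.2 c' hc'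
    simp [h1, h2, hB q c', h3]
  have hhiso : ∀ u ∈ M, ∀ v ∈ M, B (h u) (h v) = B u v := fun u hu v hv => by
    obtain ⟨q, hq, c, hc, rfl, h1⟩ := hdec u hu
    obtain ⟨q', hq', c', hc', rfl, h2⟩ := hdec v hv
    rw [h1, h2, hadd M' _ (hQ' ▸ hrQ q hq) _ (hQ' ▸ hrQ q' hq') _ (hsM c (hCM hc)) _
      (hsM c' (hCM hc')), hs c (hCM hc) c' (hCM hc'),
      hadd M q (hQ ▸ hq) q' (hQ ▸ hq') c (hCM hc) c' (hCM hc')]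
  have hhinj : ∀ u ∈ M, h u = 0 → u = 0 := fun u hu h0 => by
    obtain ⟨q, hq, c, hc, rfl, h1⟩ := hdec u hu
    rw [h1] at h0
    have h2 : c = 0 := by
      refine hC c ((hsQ c (hCM hc)).mp ?_) hc
      rw [eq_neg_of_add_eq_zero_right h0]
      exact Q'.neg_mem (hrQ q hq)
    rw [h2, map_zero, add_zero] at h0
    rw [h2, hrinj q hq h0, add_zero]
  have hhP : ∀ u ∈ M ⊓ R, h u = a₂ u := fun u hu => by
    rw [hhQ u (hMRQ hu), hr u (Submodule.mem_sup_right hu), haP u hu]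
  obtain ⟨g, hg, hginj, hgM⟩ := exists_isometry_extending_of_ker hchar hB M h hhiso hhinj
    fun u hu => by
      rw [← hR]
      refine ⟨fun h1 => ?_, fun h1 => ?_⟩
      · have h2 : h u ∈ M' ⊓ R := ⟨hhM u hu, h1⟩
        rw [← map_eq_of_injOn_of_finrank_eq a₂ ha₂P ha₂inj hMR] at h2
        obtain ⟨p, hp, hpu⟩ := h2
        rw [sub_eq_zero.mp (hhinj (u - p) (M.sub_mem hu hp.1)
          (by rw [map_sub, hhP p hp, hpu, sub_self]))]
        exact hp.2
      · rw [hhP u ⟨hu, h1⟩]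
        exact (ha₂P u ⟨hu, h1⟩).2
  refine ⟨g, hg, hginj, fun u hu => hgM u hu ▸ hhM u hu, fun u hu => ?_⟩
  rw [hgM u (hIleM hu), hhQ u (hIM hu), hr u (Submodule.mem_sup_left hu), haI u hu]
  exact ha₁I u hu

theorem orthogonal_inf_orthogonal [FiniteDimensional F V]
    {B : LinearMap.BilinForm F V} (hB : ∀ u v, B u v = B v u) (hnd : B.Nondegenerate)
    (E A : Submodule F V) : B.orthogonal (E ⊓ B.orthogonal A) = A ⊔ B.orthogonal E := by
  have hr : B.IsRefl := fun u v h => by rw [hB, h]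
  have h : B.orthogonal (A ⊔ B.orthogonal E) = E ⊓ B.orthogonal A := by
    refine le_antisymm (le_inf ?_ (LinearMap.BilinForm.orthogonal_le le_sup_left)) ?_
    · exact (LinearMap.BilinForm.orthogonal_le le_sup_right).trans
        (LinearMap.BilinForm.orthogonal_orthogonal hnd hr E).le
    · rintro u ⟨hu, huA⟩ v hv
      obtain ⟨a, ha, e, he, rfl⟩ := Submodule.mem_sup.mp hv
      have h1 : B a u = 0 := huA a ha
      have h2 : B u e = 0 := he u hu
      simp [h1, hB e u, h2]
  rw [← h, LinearMap.BilinForm.orthogonal_orthogonal hnd hr]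

/-- Totally isotropic subspaces of equal dimension having the same intersections and the same
orthogonality relations with `E` are conjugate under an isometry fixing `E` pointwise. -/
theorem exists_isometry_fixing_and_mapsTo [FiniteDimensional F V] (hchar : (2 : F) ≠ 0)
    {B : LinearMap.BilinForm F V} (hB : ∀ u v, B u v = B v u) (hnd : B.Nondegenerate)
    {E A A' : Submodule F V} (hA : TotIsotropic B A) (hA' : TotIsotropic B A')
    (hEA : E ⊓ A = E ⊓ A') (hEAo : E ⊓ B.orthogonal A = E ⊓ B.orthogonal A')
    (hd : finrank F A = finrank F A') :
    ∃ g : V →ₗ[F] V, (∀ u v, B (g u) (g v) = B u v) ∧ (∀ u ∈ E, g u = u) ∧ ∀ u ∈ A, g u ∈ A' := by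
  obtain ⟨P, hP⟩ : ∃ P, P = B.orthogonal E := ⟨_, rfl⟩
  have hPE : ∀ p ∈ P, ∀ u ∈ E, B u p = 0 := fun p hp u hu => (hP ▸ hp) u hu
  have hsup : A ⊔ P = A' ⊔ P := by
    rw [hP, ← orthogonal_inf_orthogonal hB hnd, hEAo, orthogonal_inf_orthogonal hB hnd]
  have hmem : ∀ u ∈ E, u ∈ A ↔ u ∈ A' := fun u hu =>
    ⟨fun h => (hEA ▸ (⟨hu, h⟩ : u ∈ E ⊓ A) : u ∈ E ⊓ A').2,
      fun h => (hEA.symm ▸ (⟨hu, h⟩ : u ∈ E ⊓ A') : u ∈ E ⊓ A).2⟩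
  have hK : finrank F ↥(A ⊓ P) = finrank F ↥(A' ⊓ P) := by
    have h1 := Submodule.finrank_sup_add_finrank_inf_eq A P
    have h2 := Submodule.finrank_sup_add_finrank_inf_eq A' P
    rw [hsup] at h1
    omega
  obtain ⟨k, hk, hkK, hkinj⟩ := exists_injOn_extension (S := E ⊓ A ⊓ P) (X := A ⊓ P) (Y := A' ⊓ P)
    (inf_le_inf_right P inf_le_right) LinearMap.id
    (fun u hu => ⟨(hmem u hu.1.1).mp hu.1.2, hu.2⟩) (fun u _ h => h) hK
  obtain ⟨g₁, hg₁I, hg₁K⟩ := exists_linearMap_glue (S := E ⊓ A) (T := A ⊓ P) LinearMap.id k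
    fun u hu hu' => (hk u ⟨hu, hu'.2⟩).symm
  obtain ⟨D, hDA, hD, hDsup⟩ := exists_disjoint_sup_eq (inf_le_left : A' ⊓ P ≤ A')
  obtain ⟨t, htD, htP⟩ := exists_linearMap_glue (S := D) (T := P) LinearMap.id (0 : V →ₗ[F] V)
    fun u hu hu' => Submodule.disjoint_def.mp hD u ⟨hDA hu, hu'⟩ hu
  have ht : ∀ u ∈ A, t u ∈ A' ∧ t u - u ∈ P := fun u hu => by
    have h1 : u ∈ A' ⊔ P := hsup ▸ Submodule.mem_sup_left hu
    rw [← hDsup, sup_right_comm, sup_eq_right.mpr (inf_le_right : A' ⊓ P ≤ P),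
      sup_comm] at h1
    obtain ⟨d, hd, p, hp, rfl⟩ := Submodule.mem_sup.mp h1
    rw [map_add, htD d hd, htP p hp]
    simpa using ⟨hDA hd, hp⟩
  have hSA : E ⊓ A ⊔ A ⊓ P ≤ A := sup_le inf_le_right inf_le_left
  obtain ⟨C, hCA, hC, hCsup⟩ := exists_disjoint_sup_eq hSA
  obtain ⟨g, hgS, hgC⟩ := exists_linearMap_glue (S := E ⊓ A ⊔ A ⊓ P) (T := C) g₁ t
    fun u hu hu' => by simp [Submodule.disjoint_def.mp hC u hu hu']
  have hgI : ∀ u ∈ E ⊓ A, g u = u := fun u hu => by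
    rw [hgS u (Submodule.mem_sup_left hu), hg₁I u hu, LinearMap.id_apply]
  have hgK : ∀ u ∈ A ⊓ P, g u = k u := fun u hu => by
    rw [hgS u (Submodule.mem_sup_right hu), hg₁K u hu]
  have hgA : ∀ u ∈ A, g u ∈ A' ∧ g u - u ∈ P := fun u hu => by
    rw [← hCsup] at hu
    obtain ⟨v, hv, c, hc, rfl⟩ := Submodule.mem_sup.mp hu
    obtain ⟨i, hi, p, hp, rfl⟩ := Submodule.mem_sup.mp hv
    rw [map_add, map_add, hgI i hi, hgK p hp, hgC c hc]
    have htc := ht c (hCA hc)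
    have hkp := hkK p hp
    refine ⟨A'.add_mem (A'.add_mem ((hmem i hi.1).mp hi.2) hkp.1) htc.1, ?_⟩
    rw [show i + k p + t c - (i + p + c) = k p - p + (t c - c) by abel]
    exact P.add_mem (P.sub_mem hkp.2 hp.2) htc.2
  have hginj : ∀ u ∈ A, g u = 0 → u = 0 := fun u hu h0 => by
    have h1 := (hgA u hu).2
    rw [h0, zero_sub, P.neg_mem_iff] at h1
    exact hkinj u ⟨hu, h1⟩ (by rw [← hgK u ⟨hu, h1⟩, h0])
  obtain ⟨h, hhE, hhA⟩ := exists_linearMap_glue (S := E) (T := A) LinearMap.id g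
    fun u hu hu' => (hgI u ⟨hu, hu'⟩).symm
  have hEg : ∀ u ∈ E, ∀ a ∈ A, B u (g a) = B u a := fun u hu a ha => by
    rw [← sub_eq_zero, ← map_sub, hPE _ (hgA a ha).2 u hu]
  obtain ⟨G, hG, hGh⟩ := exists_isometry_extending_end hchar hB hnd (E ⊔ A) h
    (fun u hu v hv => by
      obtain ⟨e, he, a, ha, rfl⟩ := Submodule.mem_sup.mp hu
      obtain ⟨e', he', a', ha', rfl⟩ := Submodule.mem_sup.mp hv
      rw [map_add h, map_add h, hhE e he, hhE e' he', hhA a ha, hhA a' ha']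
      simp only [LinearMap.id_apply, map_add, LinearMap.add_apply, hEg e he a' ha',
        hB _ e', hEg e' he' a ha, hA a ha a' ha', hA' _ (hgA a ha).1 _ (hgA a' ha').1])
    (fun u hu h0 => by
      obtain ⟨e, he, a, ha, rfl⟩ := Submodule.mem_sup.mp hu
      have h1 : h (e + a) = e + g a := by rw [map_add, hhE e he, hhA a ha, LinearMap.id_apply]
      have h2 : e ∈ A := by
        rw [hmem e he, eq_neg_of_add_eq_zero_left (h1.symm.trans h0)]
        exact A'.neg_mem (hgA a ha).1
      exact hginj _ (A.add_mem h2 ha) (by rw [← hhA _ (A.add_mem h2 ha), h0]))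
  refine ⟨G, hG, fun u hu => ?_, fun u hu => ?_⟩
  · rw [hGh u (Submodule.mem_sup_left hu), hhE u hu, LinearMap.id_apply]
  · rw [hGh u (Submodule.mem_sup_right hu), hhA u hu]
    exact (hgA u hu).1

theorem comap_orthogonal {B : LinearMap.BilinForm F V} {B' : LinearMap.BilinForm F V'}
    {φ : V ≃ₗ[F] V'} (hφ : IsIsometry B B' φ) (N : Submodule F V') :
    (B'.orthogonal N).comap φ.toLinearMap = B.orthogonal (N.comap φ.toLinearMap) := by
  ext u
  refine ⟨fun h v hv => (hφ v u).symm.trans (h (φ v) hv), fun h v hv => ?_⟩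
  have h1 : B (φ.symm v) u = 0 := h (φ.symm v) (by simpa using hv)
  rw [← hφ, φ.apply_symm_apply] at h1
  exact h1

theorem finrank_comap_equiv (φ : V ≃ₗ[F] V') (N : Submodule F V') :
    finrank F (N.comap φ.toLinearMap) = finrank F N := by
  rw [← LinearEquiv.finrank_map_eq φ (N.comap φ.toLinearMap),
    Submodule.map_comap_eq_of_surjective φ.surjective]

theorem finrank_comap_subtype (E X : Submodule F V) :
    finrank F (X.comap E.subtype) = finrank F ↥(E ⊓ X) := by
  rw [← Submodule.map_comap_subtype, Submodule.finrank_map_subtype_eq]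

theorem subIsometric_comap {B : LinearMap.BilinForm F V} {B' : LinearMap.BilinForm F V'}
    {φ : V ≃ₗ[F] V'} (hφ : IsIsometry B B' φ) (N : Submodule F V') :
    SubIsometric B B' (N.comap φ.toLinearMap) N :=
  ⟨φ.ofSubmodule' N, fun u v => hφ u v⟩

theorem SubIsometric.comap_right {U : Type*} [AddCommGroup U] [Module F U]
    {C : LinearMap.BilinForm F U} {B : LinearMap.BilinForm F V}
    {B' : LinearMap.BilinForm F V'} {φ : V ≃ₗ[F] V'} (hφ : IsIsometry B B' φ)
    {M : Submodule F U} {N : Submodule F V'} (h : SubIsometric C B' M N) :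
    SubIsometric C B M (N.comap φ.toLinearMap) := by
  obtain ⟨σ, hσ⟩ := h
  refine ⟨σ.trans (φ.ofSubmodule' N).symm, fun u v => ?_⟩
  rw [← hσ, ← hφ]
  simp

/-- An isometric endomorphism of a nonsingular space, as a linear equivalence. -/
theorem exists_linearEquiv_of_isometry [FiniteDimensional F V] {B : LinearMap.BilinForm F V}
    (hnd : B.Nondegenerate) {g : V →ₗ[F] V} (hg : ∀ u v, B (g u) (g v) = B u v) :
    ∃ e : V ≃ₗ[F] V, IsIsometry B B e ∧ e.toLinearMap = g :=
  ⟨LinearEquiv.ofInjectiveEndo g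
    ((injective_iff_map_eq_zero g).mpr fun _ hu => eq_zero_of_isometry hnd hg hu), hg, rfl⟩

/-- Witt's extension theorem, for an isometry between subspaces of isometric spaces. -/
theorem exists_isIsometry_comap_eq [FiniteDimensional F V] (hchar : (2 : F) ≠ 0)
    {B : LinearMap.BilinForm F V} {B' : LinearMap.BilinForm F V'}
    (hB : ∀ u v, B u v = B v u) (hnd : B.Nondegenerate) (hBB' : AreIsometric B B')
    {E : Submodule F V} {E' : Submodule F V'} (hE : SubIsometric B B' E E') :
    ∃ φ : V ≃ₗ[F] V', IsIsometry B B' φ ∧ E'.comap φ.toLinearMap = E := by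
  obtain ⟨ψ, hψ⟩ := hBB'
  obtain ⟨σ, hσ⟩ := hE
  obtain ⟨f, hf⟩ := LinearMap.exists_extend
    (ψ.symm.toLinearMap ∘ₗ E'.subtype ∘ₗ σ.toLinearMap)
  have hfσ : ∀ u (hu : u ∈ E), ψ (f u) = σ ⟨u, hu⟩ := fun u hu => by
    rw [show f u = ψ.symm (σ ⟨u, hu⟩) from LinearMap.congr_fun hf ⟨u, hu⟩, ψ.apply_symm_apply]
  obtain ⟨g, hg, hgf⟩ := exists_isometry_extending_end hchar hB hnd E f
    (fun u hu v hv => by rw [← hψ, hfσ u hu, hfσ v hv]; exact hσ ⟨u, hu⟩ ⟨v, hv⟩)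
    (fun u hu h0 => by
      have h1 := hfσ u hu
      rw [h0, map_zero] at h1
      exact congrArg Subtype.val (σ.map_eq_zero_iff.mp (Subtype.ext h1.symm)))
  obtain ⟨e, he, rfl⟩ := exists_linearEquiv_of_isometry hnd hg
  have heσ : ∀ u (hu : u ∈ E), ψ (e u) = σ ⟨u, hu⟩ := fun u hu => by
    rw [← hfσ u hu, ← hgf u hu]; rfl
  refine ⟨e.trans ψ, fun u v => (hψ _ _).trans (he u v), ?_⟩
  ext u
  refine ⟨fun hu => ?_, fun hu => ?_⟩
  · have h1 := heσ (σ.symm ⟨_, hu⟩) (σ.symm ⟨_, hu⟩).2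
    rw [Subtype.coe_eta, σ.apply_symm_apply] at h1
    rw [← e.injective (ψ.injective h1)]
    exact (σ.symm ⟨_, hu⟩).2
  · change ψ (e u) ∈ E'
    rw [heσ u hu]
    exact (σ _).2

/-- The invariants of `(E, A)` determine the totally isotropic subspace `A` up to isometries
preserving `E`. -/
theorem exists_isometry_mapsTo_self_mapsTo [FiniteDimensional F V] (hchar : (2 : F) ≠ 0)
    {B : LinearMap.BilinForm F V} (hB : ∀ u v, B u v = B v u) (hnd : B.Nondegenerate)
    {E A A' : Submodule F V} (hA : TotIsotropic B A) (hA' : TotIsotropic B A')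
    (hd : finrank F A = finrank F A')
    (hM : SubIsometric B B (E ⊓ B.orthogonal A) (E ⊓ B.orthogonal A'))
    (hI : finrank F ↥(E ⊓ A) = finrank F ↥(E ⊓ A'))
    (hIR : finrank F ↥(B.orthogonal E ⊓ E ⊓ A) = finrank F ↥(B.orthogonal E ⊓ E ⊓ A'))
    (hMR : finrank F ↥(B.orthogonal E ⊓ E ⊓ B.orthogonal A) =
      finrank F ↥(B.orthogonal E ⊓ E ⊓ B.orthogonal A')) :
    ∃ e : V ≃ₗ[F] V, IsIsometry B B e ∧ E.map e.toLinearMap = E ∧ A.map e.toLinearMap = A' := by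
  have hker : LinearMap.ker (B.restrict E) = (B.orthogonal E).comap E.subtype := by
    ext u
    rw [LinearMap.mem_ker]
    refine ⟨fun h v hv => (hB v u).trans (LinearMap.congr_fun h ⟨v, hv⟩), fun h => ?_⟩
    ext v
    exact (hB u v).trans (h v v.2)
  have hrank : ∀ X : Submodule F V,
      finrank F ↥(X.comap E.subtype ⊓ LinearMap.ker (B.restrict E)) =
        finrank F ↥(B.orthogonal E ⊓ E ⊓ X) := fun X => by
    rw [hker, ← Submodule.comap_inf, finrank_comap_subtype, inf_comm X, ← inf_assoc,
      inf_comm E]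
  have hrad : ∀ X : Submodule F V, TotIsotropic B X → X.comap E.subtype ≤
      (B.orthogonal X).comap E.subtype ⊓
        (B.restrict E).orthogonal ((B.orthogonal X).comap E.subtype) := fun X hX u hu =>
    ⟨fun v hv => hX v hv u hu, fun v hv => (hB v u).trans (hv u hu)⟩
  obtain ⟨σ, hσ⟩ := hM
  obtain ⟨s, hs⟩ := LinearMap.exists_extend (p := (B.orthogonal A).comap E.subtype)
    ((Submodule.inclusion inf_le_left ∘ₗ σ.toLinearMap ∘ₗ
      LinearMap.codRestrict (E ⊓ B.orthogonal A) (E.subtype ∘ₗ Submodule.subtype _)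
        fun u => ⟨u.1.2, u.2⟩) : _ →ₗ[F] E)
  have hsσ : ∀ u (hu : u ∈ (B.orthogonal A).comap E.subtype), (s u : V) = σ ⟨u, u.2, hu⟩ :=
    fun u hu => congrArg Subtype.val (LinearMap.congr_fun hs ⟨u, hu⟩)
  obtain ⟨f, hf, hfinj, hfM, hfI⟩ := exists_isometry_mapsTo_mapsTo (B := B.restrict E) hchar
    (fun u v => hB u v) (hrad A hA) (hrad A' hA') s
    (fun u hu v hv => by
      change B (s u : V) (s v : V) = B u v
      rw [hsσ u hu, hsσ v hv, hσ])
    (fun u hu => by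
      change (s u : V) ∈ B.orthogonal A'
      rw [hsσ u hu]
      exact (σ _).2.2)
    (fun u hu h0 => by
      have h1 := hsσ u hu
      rw [h0] at h1
      have h2 := σ.map_eq_zero_iff.mp (Subtype.ext h1.symm)
      have h3 : (u : V) = 0 := congrArg (Submodule.subtype (E ⊓ B.orthogonal A)) h2
      exact Subtype.ext h3)
    (by rw [finrank_comap_subtype, finrank_comap_subtype, σ.finrank_eq])
    (by rw [finrank_comap_subtype, finrank_comap_subtype, hI])
    (by rw [hrank, hrank, hIR]) (by rw [hrank, hrank, hMR])
  obtain ⟨h, hh⟩ := LinearMap.exists_extend (E.subtype ∘ₗ f)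
  have hhf : ∀ u (hu : u ∈ E), h u = f ⟨u, hu⟩ := fun u hu => LinearMap.congr_fun hh ⟨u, hu⟩
  obtain ⟨g, hg, hgh⟩ := exists_isometry_extending_end hchar hB hnd E h
    (fun u hu v hv => by rw [hhf u hu, hhf v hv]; exact hf ⟨u, hu⟩ ⟨v, hv⟩)
    (fun u hu h0 => by
      rw [hhf u hu] at h0
      exact congrArg Subtype.val (hfinj ⟨u, hu⟩ (Subtype.ext h0)))
  obtain ⟨e, he, rfl⟩ := exists_linearEquiv_of_isometry hnd hg
  have hef : ∀ u (hu : u ∈ E), e u = f ⟨u, hu⟩ := fun u hu => (hgh u hu).trans (hhf u hu)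
  have heinj : ∀ N : Submodule F V, ∀ u ∈ N, e.toLinearMap u = 0 → u = 0 :=
    fun N u _ h0 => e.map_eq_zero_iff.mp h0
  have heE : E.map e.toLinearMap = E := map_eq_of_injOn_of_finrank_eq _
    (fun u hu => by
      change e u ∈ E
      rw [hef u hu]
      exact (f _).2) (heinj E) rfl
  have heE' : E.comap e.toLinearMap = E := by
    conv_lhs => rw [← heE]
    exact Submodule.comap_map_eq_of_injective e.injective E
  have key : ∀ X X' : Submodule F V, (∀ u ∈ X.comap E.subtype, f u ∈ X'.comap E.subtype) →
      finrank F ↥(E ⊓ X) = finrank F ↥(E ⊓ X') → E ⊓ X = E ⊓ X'.comap e.toLinearMap :=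
    fun X X' hX hXX' => by
      refine Submodule.eq_of_le_of_finrank_eq (fun u hu => ⟨hu.1, ?_⟩) ?_
      · change e u ∈ X'
        rw [hef u hu.1]
        exact hX ⟨u, hu.1⟩ hu.2
      · conv_rhs => rw [← heE', ← Submodule.comap_inf, finrank_comap_equiv]
        exact hXX'
  obtain ⟨k, hk, hkE, hkA⟩ := exists_isometry_fixing_and_mapsTo (E := E) (A := A)
    (A' := A'.comap e.toLinearMap) hchar hB hnd hA
    (fun u hu v hv => by rw [← he]; exact hA' _ hu _ hv) (key A A' hfI hI)
    (by rw [key _ _ hfM σ.finrank_eq, comap_orthogonal he]) (by rw [finrank_comap_equiv, hd])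
  obtain ⟨e', he', rfl⟩ := exists_linearEquiv_of_isometry hnd hk
  refine ⟨e'.trans e, fun u v => (he _ _).trans (he' u v),
    map_eq_of_injOn_of_finrank_eq _ (fun u hu => ?_)
      (fun u _ h0 => (e'.trans e).map_eq_zero_iff.mp h0) rfl,
    map_eq_of_injOn_of_finrank_eq _ hkA (fun u _ h0 => (e'.trans e).map_eq_zero_iff.mp h0) hd⟩
  have h1 : e (e' u) = e u := congrArg e (hkE u hu)
  have h2 : e u ∈ E := heE'.ge hu
  exact h1 ▸ h2

end Witt

open Module Witt

/-- Corollary 6.3: for totally isotropic `A ≈ A'` and `E ≈ E'`, there is an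
isometry `φ_V : V → V'` sending `E` to `E'` and `A` to `A'` iff
`E ∩ A^⊥ ≈ E' ∩ A'^⊥`, `dim(E ∩ A) = dim(E' ∩ A')`,
`dim(E^⊥ ∩ E ∩ A) = dim(E'^⊥ ∩ E' ∩ A')`, and
`dim(E^⊥ ∩ E ∩ A^⊥) = dim(E'^⊥ ∩ E' ∩ A'^⊥)`. -/
theorem witt_pair_totally_isotropic {F V V' : Type*} [Field F]
    [AddCommGroup V] [Module F V] [AddCommGroup V'] [Module F V']
    [FiniteDimensional F V] [FiniteDimensional F V']
    (hchar : (2 : F) ≠ 0)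
    (B : LinearMap.BilinForm F V) (B' : LinearMap.BilinForm F V')
    (hB : ∀ u v : V, B u v = B v u) (hB' : ∀ u v : V', B' u v = B' v u)
    (hnd : B.Nondegenerate) (hnd' : B'.Nondegenerate)
    (hVV' : AreIsometric B B')
    (E A : Submodule F V) (E' A' : Submodule F V')
    (hA : TotIsotropic B A) (hA' : TotIsotropic B' A')
    (hAA' : SubIsometric B B' A A') (hEE' : SubIsometric B B' E E') :
    (∃ φV : V ≃ₗ[F] V', IsIsometry B B' φV ∧
        E.map φV.toLinearMap = E' ∧ A.map φV.toLinearMap = A') ↔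
      (SubIsometric B B' (E ⊓ B.orthogonal A) (E' ⊓ B'.orthogonal A') ∧
       finrank F ↥(E ⊓ A) = finrank F ↥(E' ⊓ A') ∧
       finrank F ↥(B.orthogonal E ⊓ E ⊓ A) =
         finrank F ↥(B'.orthogonal E' ⊓ E' ⊓ A') ∧
       finrank F ↥(B.orthogonal E ⊓ E ⊓ B.orthogonal A) =
         finrank F ↥(B'.orthogonal E' ⊓ E' ⊓ B'.orthogonal A')) := by
  constructor
  · rintro ⟨φ, hφ, rfl, rfl⟩
    have hcomap : ∀ N : Submodule F V, (N.map φ.toLinearMap).comap φ.toLinearMap = N :=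
      fun N => Submodule.comap_map_eq_of_injective φ.injective N
    refine ⟨?_, ?_, ?_, ?_⟩
    · have h := subIsometric_comap hφ (E.map φ.toLinearMap ⊓ B'.orthogonal (A.map φ.toLinearMap))
      rwa [Submodule.comap_inf, comap_orthogonal hφ, hcomap, hcomap] at h
    · rw [← finrank_comap_equiv φ (_ ⊓ _), Submodule.comap_inf, hcomap, hcomap]
    · rw [← finrank_comap_equiv φ (_ ⊓ _), Submodule.comap_inf, Submodule.comap_inf,
        comap_orthogonal hφ, hcomap, hcomap]
    · rw [← finrank_comap_equiv φ (_ ⊓ _), Submodule.comap_inf, Submodule.comap_inf,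
        comap_orthogonal hφ, comap_orthogonal hφ, hcomap, hcomap]
  · rintro ⟨hM, hI, hIR, hMR⟩
    obtain ⟨φ, hφ, rfl⟩ := exists_isIsometry_comap_eq hchar hB hnd hVV' hEE'
    obtain ⟨e, he, heE, heA⟩ := exists_isometry_mapsTo_self_mapsTo (E := E'.comap φ.toLinearMap)
      (A := A) (A' := A'.comap φ.toLinearMap) hchar hB hnd hA
      (fun u hu v hv => by rw [← hφ]; exact hA' _ hu _ hv)
      (by rw [finrank_comap_equiv]; exact hAA'.choose.finrank_eq)
      (by
        have h := hM.comap_right hφ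
        rwa [Submodule.comap_inf, comap_orthogonal hφ] at h)
      (by rw [hI, ← Submodule.comap_inf, finrank_comap_equiv])
      (by rw [hIR, ← comap_orthogonal hφ, ← Submodule.comap_inf, ← Submodule.comap_inf,
        finrank_comap_equiv])
      (by rw [hMR, ← comap_orthogonal hφ, ← comap_orthogonal hφ, ← Submodule.comap_inf,
        ← Submodule.comap_inf, finrank_comap_equiv])
    refine ⟨e.trans φ, fun u v => (hφ _ _).trans (he u v), ?_, ?_⟩
    · rw [LinearEquiv.coe_trans, Submodule.map_comp, heE,
        Submodule.map_comap_eq_of_surjective φ.surjective]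
    · rw [LinearEquiv.coe_trans, Submodule.map_comp, heA,
        Submodule.map_comap_eq_of_surjective φ.surjective]
end

section
/- Let A and B be subspaces of a finite-dimensional metric space (V,b) over F (possibly singular). Then dim A − dim(A ∩ B^⊥) = dim B − dim(B ∩ A^⊥). -/
open Module

theorem LinearMap.finrank_range_flip {F M N : Type*} [Field F] [AddCommGroup M] [Module F M]
    [AddCommGroup N] [Module F N] [FiniteDimensional F N] (f : M →ₗ[F] N →ₗ[F] F) :
    finrank F (LinearMap.range f.flip) = finrank F (LinearMap.range f) := by
  have h : f.flip = f.dualMap ∘ₗ (evalEquiv F N).toLinearMap := by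
    ext n m
    simp
  rw [h, LinearMap.range_comp_of_range_eq_top _ (LinearEquiv.range _),
    LinearMap.finrank_range_dualMap_eq_finrank_range]

theorem LinearMap.BilinForm.finrank_range_domRestrict₁₂_add_finrank_inf_orthogonal
    {F V : Type*} [Field F] [AddCommGroup V] [Module F V] [FiniteDimensional F V]
    (b : LinearMap.BilinForm F V) (hsymm : ∀ u v : V, b u v = b v u) (A B : Submodule F V) :
    finrank F (LinearMap.range (b.domRestrict₁₂ A B)) + finrank F ↥(A ⊓ b.orthogonal B) =
      finrank F A := by
  have h : LinearMap.ker (b.domRestrict₁₂ A B) = (b.orthogonal B).comap A.subtype := by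
    ext a
    simp [LinearMap.ext_iff, LinearMap.BilinForm.mem_orthogonal_iff,
      LinearMap.domRestrict₁₂_apply, hsymm a.1]
  rw [← LinearMap.finrank_range_add_finrank_ker (b.domRestrict₁₂ A B), h,
    ← Submodule.map_comap_subtype, Submodule.finrank_map_subtype_eq]

theorem witt_dim_identity {F V : Type*} [Field F] [AddCommGroup V] [Module F V]
    [FiniteDimensional F V] (hchar : (2 : F) ≠ 0)
    (b : LinearMap.BilinForm F V) (hsymm : ∀ u v : V, b u v = b v u)
    (A B : Submodule F V) :
    finrank F ↥A - finrank F ↥(A ⊓ b.orthogonal B) =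
      finrank F ↥B - finrank F ↥(B ⊓ b.orthogonal A) := by
  have hflip : b.domRestrict₁₂ B A = (b.domRestrict₁₂ A B).flip := by
    ext u v
    exact hsymm u v
  have hA := b.finrank_range_domRestrict₁₂_add_finrank_inf_orthogonal hsymm A B
  have hB := b.finrank_range_domRestrict₁₂_add_finrank_inf_orthogonal hsymm B A
  rw [hflip, LinearMap.finrank_range_flip] at hB
  omega
end
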